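/- arXiv:0907.3295 — 5 statements merged into one kernel-verified Lean document; each statement's English description precedes it below -/
import Mathlib

section
/- If E ⊆ H is a precisely monotone subset of the Heisenberg group, then either E = ∅, or E = H, or there is a half-space C ⊂ H with C ⊆ E ⊆ closure(C). -/
open MeasureTheory Set Topology Filter

noncomputable section

/-- The Heisenberg group as a set: `ℝ³`. -/
abbrev Heis : Type := ℝ × ℝ × ℝ

/-- The Heisenberg group multiplication
`(a,b,c)·(a',b',c') = (a+a', b+b', c+c'+a·b')`. -/
def hMul (x y : Heis) : Heis :=
  (x.1 + y.1, x.2.1 + y.2.1, x.2.2 + y.2.2 + x.1 * y.2.1)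

/-- The abelianization homomorphism `π : H → ℝ²`, `π(a,b,c) = (a,b)`. -/
def hPi (x : Heis) : ℝ × ℝ := (x.1, x.2.1)

/-- The (horizontal) line of the Heisenberg group through `g` with direction `(a,b)`:
`{g·(ta, tb, t²ab/2) : t ∈ ℝ}`. -/
def hLine (g : Heis) (a b : ℝ) : Set Heis :=
  {p | ∃ t : ℝ, p = hMul g (t * a, t * b, t ^ 2 * a * b / 2)}

/-- A subset of the Heisenberg group is a (horizontal) line. -/
def IsLine (L : Set Heis) : Prop :=
  ∃ g : Heis, ∃ a b : ℝ, ¬(a = 0 ∧ b = 0) ∧ L = hLine g a b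

/-- Two lines of `H` are parallel if their `π`-images are parallel straight lines
in `ℝ²`, i.e. their direction vectors are linearly dependent. -/
def AreParallelLines (L₁ L₂ : Set Heis) : Prop :=
  ∃ g₁ g₂ : Heis, ∃ a₁ b₁ a₂ b₂ : ℝ,
    ¬(a₁ = 0 ∧ b₁ = 0) ∧ ¬(a₂ = 0 ∧ b₂ = 0) ∧
    L₁ = hLine g₁ a₁ b₁ ∧ L₂ = hLine g₂ a₂ b₂ ∧ a₁ * b₂ = a₂ * b₁

/-- Two lines of `H` are skew if they are disjoint and not parallel. -/
def AreSkewLines (L₁ L₂ : Set Heis) : Prop :=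
  IsLine L₁ ∧ IsLine L₂ ∧ Disjoint L₁ L₂ ∧ ¬ AreParallelLines L₁ L₂

/-- A straight line in `ℝ²`. -/
def IsLineR2 (l : Set (ℝ × ℝ)) : Prop :=
  ∃ p v : ℝ × ℝ, v ≠ 0 ∧ l = {q | ∃ t : ℝ, q = p + t • v}

/-- The horizontal plane centered at `g`: the union of all lines through `g`. -/
def horizPlane (g : Heis) : Set Heis :=
  {p | ∃ L : Set Heis, IsLine L ∧ g ∈ L ∧ p ∈ L}

/-- A plane of the Heisenberg group: a vertical plane `π⁻¹(ℓ)` for a straight line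
`ℓ ⊂ ℝ²`, or a horizontal plane. -/
def IsPlane (P : Set Heis) : Prop :=
  (∃ l : Set (ℝ × ℝ), IsLineR2 l ∧ P = hPi ⁻¹' l) ∨ (∃ g : Heis, P = horizPlane g)

/-- A half-space of the Heisenberg group: a connected component of the complement
of a plane. -/
def IsHalfSpace (C : Set Heis) : Prop :=
  ∃ P : Set Heis, ∃ x : Heis, IsPlane P ∧ x ∉ P ∧ C = connectedComponentIn Pᶜ x

/-- A subset `E` of the Heisenberg group is precisely monotone if every line
intersects both `E` and its complement in connected sets. -/
def IsPreciselyMonotone (E : Set Heis) : Prop :=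
  ∀ L : Set Heis, IsLine L → IsPreconnected (L ∩ E) ∧ IsPreconnected (L ∩ Eᶜ)

/-- In exponential coordinates (with the central coordinate doubled), two points lie on a common
horizontal line. -/
def Incident (p q : Heis) : Prop :=
  q.2.2 - p.2.2 = p.1 * q.2.1 - q.1 * p.2.1

/-- A set is convex along horizontal lines. -/
def HorizConvex (E : Set Heis) : Prop :=
  ∀ p q, Incident p q → p ∈ E → q ∈ E → ∀ t : ℝ, 0 ≤ t → t ≤ 1 → p + t • (q - p) ∈ E

/-- A set contains every horizontal line meeting it in at least two points. -/
def LineClosed (B : Set Heis) : Prop :=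
  ∀ p q, Incident p q → p ≠ q → p ∈ B → q ∈ B → ∀ t : ℝ, p + t • (q - p) ∈ B

/-- The point at time `t` on the horizontal line through `p` with direction `(a, b)`. -/
def horizPt (p : Heis) (a b t : ℝ) : Heis :=
  (p.1 + t * a, p.2.1 + t * b, p.2.2 + t * (p.1 * b - p.2.1 * a))

theorem Incident.symm {p q : Heis} (h : Incident p q) : Incident q p := by
  unfold Incident at *; linarith

/-- An affine homeomorphism which respects incidence. -/
def IsFrame (Ψ : Heis ≃ₜ Heis) : Prop :=
  (∀ (p q : Heis) (t : ℝ), Ψ (p + t • (q - p)) = Ψ p + t • (Ψ q - Ψ p)) ∧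
    ∀ p q, Incident (Ψ p) (Ψ q) ↔ Incident p q

/-- The automorphism of the horizontal geometry that takes the origin to `m` and the first two
coordinate directions to `(u₁, u₂)` and `(w₁, w₂)`. -/
def frame (m : Heis) (u₁ u₂ w₁ w₂ : ℝ) (h : u₁ * w₂ - u₂ * w₁ ≠ 0) : Heis ≃ₜ Heis where
  toFun p := (m.1 + p.1 * u₁ + p.2.1 * w₁, m.2.1 + p.1 * u₂ + p.2.1 * w₂,
    m.2.2 + (u₁ * w₂ - u₂ * w₁) * p.2.2 + m.1 * (p.1 * u₂ + p.2.1 * w₂)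
      - m.2.1 * (p.1 * u₁ + p.2.1 * w₁))
  invFun q := (((q.1 - m.1) * w₂ - (q.2.1 - m.2.1) * w₁) / (u₁ * w₂ - u₂ * w₁),
    (u₁ * (q.2.1 - m.2.1) - u₂ * (q.1 - m.1)) / (u₁ * w₂ - u₂ * w₁),
    (q.2.2 - m.2.2 - m.1 * (q.2.1 - m.2.1) + m.2.1 * (q.1 - m.1)) / (u₁ * w₂ - u₂ * w₁))
  left_inv p := by
    ext <;> dsimp only <;> rw [div_eq_iff h] <;> ring
  right_inv q := by
    have hi := mul_inv_cancel₀ h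
    ext <;> simp only [div_eq_mul_inv]
    · linear_combination (q.1 - m.1) * hi
    · linear_combination (q.2.1 - m.2.1) * hi
    · linear_combination (q.2.2 - m.2.2) * hi
  continuous_toFun := by fun_prop
  continuous_invFun := by fun_prop

theorem isFrame_frame (m : Heis) (u₁ u₂ w₁ w₂ : ℝ) (h : u₁ * w₂ - u₂ * w₁ ≠ 0) :
    IsFrame (frame m u₁ u₂ w₁ w₂ h) := by
  constructor
  · intro p q t
    ext <;> simp [frame] <;> ring
  · intro p q
    unfold Incident
    simp only [frame, Homeomorph.homeomorph_mk_coe, Equiv.coe_fn_mk]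
    refine ⟨fun hpq ↦ mul_left_cancel₀ h ?_, fun hpq ↦ ?_⟩
    · linear_combination hpq
    · linear_combination (u₁ * w₂ - u₂ * w₁) * hpq

theorem HorizConvex.preimage {E : Set Heis} (hE : HorizConvex E) {Ψ : Heis ≃ₜ Heis}
    (hΨ : IsFrame Ψ) : HorizConvex (Ψ ⁻¹' E) := by
  intro p q hpq hp hq t h0 h1
  rw [mem_preimage, hΨ.1]
  exact hE _ _ ((hΨ.2 _ _).2 hpq) hp hq t h0 h1

theorem LineClosed.preimage {B : Set Heis} (hB : LineClosed B) {Ψ : Heis ≃ₜ Heis}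
    (hΨ : IsFrame Ψ) : LineClosed (Ψ ⁻¹' B) := by
  intro p q hpq hne hp hq t
  rw [mem_preimage, hΨ.1]
  exact hB _ _ ((hΨ.2 _ _).2 hpq) (Ψ.injective.ne hne) hp hq t

theorem exists_isFrame {p q : Heis} (h : Incident p q) (hne : p ≠ q) :
    ∃ Ψ : Heis ≃ₜ Heis, IsFrame Ψ ∧ ∀ t : ℝ, Ψ (t, 0, 0) = q + t • (q - p) := by
  obtain ⟨x, y, z⟩ := p
  obtain ⟨x', y', z'⟩ := q
  unfold Incident at h
  dsimp only at h
  have hδ : (x' - x) * (x' - x) - (y' - y) * (-(y' - y)) ≠ 0 := by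
    intro h0
    have hx : x' = x := by nlinarith [sq_nonneg (x' - x), sq_nonneg (y' - y)]
    have hy : y' = y := by nlinarith [sq_nonneg (x' - x), sq_nonneg (y' - y)]
    subst hx hy
    exact hne (by ext <;> simp; linarith)
  refine ⟨frame (x', y', z') (x' - x) (y' - y) (-(y' - y)) (x' - x) hδ, isFrame_frame .., ?_⟩
  intro t
  ext <;> simp [frame]
  linear_combination (-t) * h

theorem interior_beyond_of_origin {E : Set Heis} (hE : HorizConvex E)
    (h1 : ((-1, 0, 0) : Heis) ∈ interior E) (h0 : ((0, 0, 0) : Heis) ∉ E) {k : ℝ} (hk : 0 < k) :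
    ((k, 0, 0) : Heis) ∈ interior Eᶜ := by
  rw [mem_interior_iff_mem_nhds] at h1 ⊢
  have c1 : ContinuousAt (fun q : Heis ↦
      ((-1, -(2 / k) * ((k / 2 * q.2.1 - q.2.2) / q.1), 0) : Heis)) (k, 0, 0) := by
    fun_prop (disch := simpa using hk.ne')
  have c2 : ContinuousAt (fun q : Heis ↦
      q + (2 * (k + 1) / k) • (((k / 2, (k / 2 * q.2.1 - q.2.2) / q.1, 0) : Heis) - q))
        (k, 0, 0) := by
    fun_prop (disch := simpa using hk.ne')
  have c3 : ContinuousAt (fun q : Heis ↦ q.1) (k, 0, 0) := by fun_prop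
  have e1 := c1.eventually_mem (s := E) (by simpa using h1)
  have e2 := c2.eventually_mem (s := E) (by
    convert h1 using 2
    ext <;> simp
    field_simp
    ring)
  have e3 := c3.eventually_ne hk.ne'
  filter_upwards [e1, e2, e3] with q hq1 hq2 hq3 hq
  obtain ⟨x, y, z⟩ := q
  dsimp only at hq1 hq2 hq3
  set b := (k / 2 * y - z) / x with hb
  have hbx : b * x = k / 2 * y - z := by rw [hb]; field_simp
  clear_value b
  have hr : ((k / 2, b, 0) : Heis) ∈ E := by
    have := hE _ _ ?_ hq hq2 (k / (2 * (k + 1))) (by positivity)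
      (by rw [div_le_one (by positivity)]; linarith)
    · convert this using 1
      ext <;> simp <;> field_simp <;> ring
    · unfold Incident
      simp
      field_simp
      linear_combination (-2 * (k + 1)) * hbx
  apply h0
  have := hE _ _ ?_ hq1 hr (1 / (1 + k / 2)) (by positivity)
      (by rw [div_le_one (by positivity)]; linarith)
  · convert this using 1
    ext <;> simp <;> field_simp <;> ring
  · unfold Incident
    simp
    field_simp
    ring

theorem interior_between_of_origin {E : Set Heis} (hE : HorizConvex E)
    (h1 : ((-1, 0, 0) : Heis) ∈ interior E) (h0 : ((0, 0, 0) : Heis) ∈ E) {k : ℝ} (hk : 0 < k)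
    (hk1 : k < 1) : ((-k, 0, 0) : Heis) ∈ interior E := by
  rw [mem_interior_iff_mem_nhds] at h1 ⊢
  have hk' : -k ≠ 0 := by linarith
  have c1 : ContinuousAt (fun q : Heis ↦
      ((-1, (2 / k) * ((-k / 2 * q.2.1 - q.2.2) / q.1), 0) : Heis)) (-k, 0, 0) := by
    fun_prop (disch := simpa using hk.ne')
  have c2 : ContinuousAt (fun q : Heis ↦
      ((-k / 2, (-k / 2 * q.2.1 - q.2.2) / q.1, 0) : Heis) +
        ((2 - k) / k) • (q - ((-k / 2, (-k / 2 * q.2.1 - q.2.2) / q.1, 0) : Heis)))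
        (-k, 0, 0) := by
    fun_prop (disch := simpa using hk.ne')
  have c3 : ContinuousAt (fun q : Heis ↦ q.1) (-k, 0, 0) := by fun_prop
  have e1 := c1.eventually_mem (s := E) (by simpa using h1)
  have e2 := c2.eventually_mem (s := E) (by
    convert h1 using 2
    ext <;> simp
    field_simp
    ring)
  have e3 := c3.eventually_ne hk'
  filter_upwards [e1, e2, e3] with q hq1 hq2 hq3
  obtain ⟨x, y, z⟩ := q
  dsimp only at hq1 hq2 hq3
  set b := (-k / 2 * y - z) / x with hb
  have hbx : b * x = -k / 2 * y - z := by rw [hb]; field_simp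
  clear_value b
  have h2k : 0 < 2 - k := by linarith
  have hr : ((-k / 2, b, 0) : Heis) ∈ E := by
    have := hE _ _ ?_ h0 hq1 (k / 2) (by positivity) (by linarith)
    · convert this using 1
      ext <;> simp <;> field_simp
    · simp [Incident]
  have := hE _ _ ?_ hr hq2 (k / (2 - k)) (by positivity)
      (by rw [div_le_one (by positivity)]; linarith)
  · convert this using 1
    ext <;> simp <;> field_simp <;> ring
  · unfold Incident
    simp
    field_simp
    linear_combination (-2 * (k - 2)) * hbx

theorem mem_interior_preimage {E : Set Heis} {Ψ : Heis ≃ₜ Heis} {p : Heis} :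
    p ∈ interior (Ψ ⁻¹' E) ↔ Ψ p ∈ interior E := by
  rw [← Ψ.preimage_interior]; rfl

theorem HorizConvex.interior_beyond {E : Set Heis} (hE : HorizConvex E) {p q : Heis}
    (h : Incident p q) (hp : p ∈ interior E) (hq : q ∉ E) {k : ℝ} (hk : 0 < k) :
    q + k • (q - p) ∈ interior Eᶜ := by
  obtain ⟨Ψ, hΨ, hΨt⟩ := exists_isFrame h (by rintro rfl; exact hq (interior_subset hp))
  rw [← hΨt, ← mem_interior_preimage]
  apply interior_beyond_of_origin (hE.preimage hΨ) _ _ hk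
  · rw [mem_interior_preimage, hΨt]; simpa using hp
  · rw [mem_preimage, hΨt]; simpa using hq

theorem HorizConvex.interior_between {E : Set Heis} (hE : HorizConvex E) {p q : Heis}
    (h : Incident p q) (hp : p ∈ interior E) (hq : q ∈ E) {k : ℝ} (hk : 0 < k) (hk1 : k < 1) :
    q - k • (q - p) ∈ interior E := by
  rcases eq_or_ne p q with rfl | hne
  · simpa using hp
  obtain ⟨Ψ, hΨ, hΨt⟩ := exists_isFrame h hne
  rw [sub_eq_add_neg, ← neg_smul, ← hΨt, ← mem_interior_preimage]
  apply interior_between_of_origin (hE.preimage hΨ) _ _ hk hk1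
  · rw [mem_interior_preimage, hΨt]; simpa using hp
  · rw [mem_preimage, hΨt]; simpa using hq

theorem Incident.lineMap {p q : Heis} (h : Incident p q) (s t : ℝ) :
    Incident (p + s • (q - p)) (p + t • (q - p)) := by
  unfold Incident at *
  simp
  linear_combination (t - s) * h

theorem eq_univ_of_incident_mem {W : Set Heis} (hW : W.Nonempty)
    (h : ∀ p ∈ W, ∀ q, Incident p q → q ∈ W) : W = univ := by
  obtain ⟨p, hp⟩ := hW
  refine eq_univ_of_forall fun q ↦ ?_
  have h1 := h p hp (0, 0, p.2.2) (by simp [Incident])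
  have h2 := h _ h1 (1, 0, p.2.2) (by simp [Incident])
  have h3 := h _ h2 (0, q.2.2 - p.2.2, q.2.2) (by simp [Incident])
  have h4 := h _ h3 (0, 0, q.2.2) (by simp [Incident])
  exact h _ h4 q (by simp [Incident])

theorem HorizConvex.eq_univ_of_interior_compl_eq_empty {E : Set Heis} (hE : HorizConvex E)
    (h : (interior E).Nonempty) (h' : interior Eᶜ = ∅) : E = univ := by
  have : interior E = univ := by
    refine eq_univ_of_incident_mem h fun p hp q hpq ↦ ?_
    have key : ∀ r, Incident p r → r ∈ E := by
      intro r hr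
      by_contra hrE
      have := hE.interior_beyond hr hp hrE one_pos
      simp [h'] at this
    have h2 : Incident p (p + (2 : ℝ) • (q - p)) := by simpa using hpq.lineMap 0 2
    have := hE.interior_between h2 hp (key _ h2) (k := 1 / 2) (by norm_num) (by norm_num)
    convert this using 1
    module
  exact univ_subset_iff.1 (this ▸ interior_subset)

/-- The topological boundary, in a form symmetric under complement. -/
def bdry (E : Set Heis) : Set Heis := (interior E ∪ interior Eᶜ)ᶜ

theorem bdry_compl (E : Set Heis) : bdry Eᶜ = bdry E := by
  simp [bdry, union_comm, inter_comm]

theorem HorizConvex.beyond_bdry {E : Set Heis} (hE : HorizConvex E) {p q : Heis}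
    (h : Incident q p) (hq : q ∈ interior E) (hp : p ∈ bdry E) {k : ℝ} (hk : 0 < k) :
    p + k • (p - q) ∈ interior Eᶜ := by
  simp only [bdry, mem_compl_iff, mem_union, not_or] at hp
  by_cases hpE : p ∈ E
  · have h2 : Incident q (p + (k / 2) • (p - q)) := by
      have := h.lineMap 0 (1 + k / 2)
      convert this using 1
      all_goals module
    have hc : k / 2 / (1 + k / 2) < 1 := by rw [div_lt_one (by positivity)]; linarith
    have hn : p + (k / 2) • (p - q) ∉ E := by
      intro hmem
      apply hp.1
      have := hE.interior_between h2 hq hmem (k := k / 2 / (1 + k / 2)) (by positivity) hc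
      convert this using 1
      match_scalars <;> field_simp <;> ring
    have := hE.interior_beyond h2 hq hn (k := k / 2 / (1 + k / 2)) (by positivity)
    convert this using 1
    match_scalars <;> field_simp <;> ring
  · exact hE.interior_beyond h hq hpE hk

theorem HorizConvex.notMem_interior_of_bdry {E : Set Heis} (hE : HorizConvex E)
    (hE' : HorizConvex Eᶜ) {p q : Heis} (h : Incident p q) (hp : p ∈ bdry E) (hq : q ∈ bdry E)
    (t : ℝ) : p + t • (q - p) ∉ interior E := by
  intro hr
  have hp' := hp
  have hq' := hq
  simp only [bdry, mem_compl_iff, mem_union, not_or] at hp' hq'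
  have hrp : Incident (p + t • (q - p)) p := by simpa using h.lineMap t 0
  have hrq : Incident (p + t • (q - p)) q := by simpa using h.lineMap t 1
  rcases lt_trichotomy t 0 with ht | rfl | ht
  · have hne := ht.ne
    apply hq'.2
    have hk : 0 < 1 / -t := one_div_pos.2 (neg_pos.2 ht)
    convert hE.beyond_bdry hrp hr hp hk using 1
    match_scalars <;> field_simp
    ring
  · simp at hr; exact hp'.1 hr
  rcases lt_trichotomy t 1 with ht1 | rfl | ht1
  · have h1 := interior_subset (hE.beyond_bdry hrp hr hp one_pos)
    have h2 := interior_subset (hE.beyond_bdry hrq hr hq one_pos)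
    have h3 := hE' _ _ ?_ h1 h2 t ht.le ht1.le
    · refine h3 ?_
      convert interior_subset hr using 1
      module
    · convert h.lineMap (-t) (2 - t) using 1 <;> module
  · simp at hr; exact hq'.1 hr
  · apply hp'.2
    have : 0 < t - 1 := by linarith
    have := hE.beyond_bdry hrq hr hq (k := 1 / (t - 1)) (by positivity)
    convert this using 1
    match_scalars <;> field_simp <;> ring

theorem HorizConvex.lineClosed_bdry {E : Set Heis} (hE : HorizConvex E)
    (hE' : HorizConvex Eᶜ) : LineClosed (bdry E) := by
  intro p q h _ hp hq t
  have h1 := hE.notMem_interior_of_bdry hE' h hp hq t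
  have h2 := hE'.notMem_interior_of_bdry (by rwa [compl_compl]) h (by rwa [bdry_compl])
    (by rwa [bdry_compl]) t
  rw [bdry, mem_compl_iff, mem_union, not_or]
  exact ⟨h1, h2⟩

theorem HorizConvex.exists_incident_bdry {E : Set Heis} (hE : HorizConvex E)
    (hE' : HorizConvex Eᶜ) {p : Heis} (hp : p ∈ bdry E) :
    ∃ q ∈ bdry E, q ≠ p ∧ Incident p q := by
  by_contra! hcon
  have hinc : ∀ d : ℝ × ℝ, Incident p (horizPt p d.1 d.2 1) := by
    intro d; simp [Incident, horizPt]; ring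
  have hcov : ∀ d : ℝ × ℝ, d ≠ 0 →
      horizPt p d.1 d.2 1 ∈ interior E ∨ horizPt p d.1 d.2 1 ∈ interior Eᶜ := by
    intro d hd
    by_contra hd'
    refine hcon _ hd' (fun h ↦ hd ?_) (hinc d)
    have h1 := congrArg Prod.fst h
    have h2 := congrArg (fun x : Heis ↦ x.2.1) h
    simp [horizPt] at h1 h2
    exact Prod.ext h1 h2
  have hopp : ∀ d : ℝ × ℝ, horizPt p (-d).1 (-d).2 1 = p + (1 : ℝ) • (p - horizPt p d.1 d.2 1) := by
    intro d; ext <;> simp [horizPt]; ring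
  have hcont : Continuous fun d : ℝ × ℝ ↦ horizPt p d.1 d.2 1 := by
    unfold horizPt; fun_prop
  have hconn : IsPreconnected ({0}ᶜ : Set (ℝ × ℝ)) :=
    (isConnected_compl_singleton_of_one_lt_rank (by simp; norm_num) 0).isPreconnected
  have hd : ((1, 0) : ℝ × ℝ) ≠ 0 := by simp
  have hd' : -((1, 0) : ℝ × ℝ) ≠ 0 := by simp
  obtain ⟨d, -, h1, h2⟩ := hconn _ _ (isOpen_interior.preimage hcont)
    ((isOpen_interior (s := Eᶜ)).preimage hcont) (fun d hd ↦ hcov d hd)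
    (by
      rcases hcov _ hd with h | h
      · exact ⟨_, hd, h⟩
      · refine ⟨_, hd', ?_⟩
        rw [mem_preimage, hopp]
        have := hE'.beyond_bdry (hinc (1, 0)).symm h (by rwa [bdry_compl]) one_pos
        rwa [compl_compl] at this)
    (by
      rcases hcov _ hd with h | h
      · refine ⟨_, hd', ?_⟩
        rw [mem_preimage, hopp]
        exact hE.beyond_bdry (hinc (1, 0)).symm h hp one_pos
      · exact ⟨_, hd, h⟩)
  exact (interior_subset h2) (interior_subset h1)

theorem LineClosed.mem_horizPt {B : Set Heis} (hB : LineClosed B) {p q : Heis}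
    (h : Incident p q) (hne : p ≠ q) (hp : p ∈ B) (hq : q ∈ B) (t : ℝ) :
    horizPt p (q.1 - p.1) (q.2.1 - p.2.1) t ∈ B := by
  convert hB p q h hne hp hq t using 1
  unfold Incident at h
  refine Prod.ext rfl (Prod.ext rfl ?_)
  simp only [horizPt, Prod.snd_add, Prod.smul_snd, Prod.snd_sub, smul_eq_mul]
  linear_combination (-t) * h

theorem LineClosed.eq_univ_of_normal {B : Set Heis} (hB : LineClosed B)
    (h1 : ∀ s : ℝ, (s, -1, s) ∈ B) (h2 : ∀ s : ℝ, (s, 1, -s) ∈ B) : B = univ := by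
  have hr : ∀ m y : ℝ, (m * y, y, -m) ∈ B := by
    intro m y
    convert hB (m, 1, -m) (-m, -1, -m) (by simp [Incident]) (by simp; norm_num) (h2 m) (h1 (-m))
      ((1 - y) / 2) using 1
    ext <;> simp <;> ring
  have hgen : ∀ x y z : ℝ, y ≠ 2 → y ≠ 1 / 2 → (x, y, z) ∈ B := by
    intro x y z hy hy'
    have e1 : 2 * y - 1 ≠ 0 := fun h ↦ hy' (by linarith)
    have e2 : 2 - y ≠ 0 := fun h ↦ hy (by linarith)
    convert hB (_, 1 / 2, _) (_, 2, _) ?_ ?_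
      (hr ((-z - (2 * x + z) / 3) / (2 * (2 - y) / 3)) (1 / 2))
      (hr ((2 * x + z) / (2 * y - 1)) 2) ((2 * y - 1) / 3) using 1
    · ext <;> simp <;> field_simp <;> ring
    · simp [Incident]; ring
    · simp; norm_num
  refine eq_univ_of_forall fun ⟨x, y, z⟩ ↦ ?_
  convert hB (x, 0, z - x * y) (x, 1, z + x * (1 - y)) ?_ ?_ (hgen _ _ _ ?_ ?_) (hgen _ _ _ ?_ ?_)
    y using 1 <;> first | (ext <;> simp; ring) | norm_num [Incident]
  ring

theorem horizPt_horizPt (p : Heis) (a b s t : ℝ) :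
    horizPt (horizPt p a b s) a b t = horizPt p a b (s + t) := by
  ext <;> simp [horizPt] <;> ring

theorem LineClosed.eq_univ_of_parallel {B : Set Heis} (hB : LineClosed B) {p q : Heis} {a b : ℝ}
    (h : a * (q.2.1 - p.2.1) - b * (q.1 - p.1) ≠ 0) (hp : ∀ t, horizPt p a b t ∈ B)
    (hq : ∀ t, horizPt q a b t ∈ B) : B = univ := by
  wlog hpq : Incident p q generalizing p
  · set s := (q.2.2 - p.2.2 - (p.1 * q.2.1 - q.1 * p.2.1)) /
      (a * (q.2.1 - p.2.1) - b * (q.1 - p.1)) with hs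
    have hs' : s * (a * (q.2.1 - p.2.1) - b * (q.1 - p.1)) =
        q.2.2 - p.2.2 - (p.1 * q.2.1 - q.1 * p.2.1) := by rw [hs]; field_simp
    clear_value s
    refine this (p := horizPt p a b s) ?_ ?_ ?_
    · convert h using 1
      simp [horizPt]
      ring
    · intro t
      rw [horizPt_horizPt]
      exact hp _
    · simp [Incident, horizPt]
      linear_combination -hs'
  have hδ : a * ((q.2.1 - p.2.1) / 2) - b * ((q.1 - p.1) / 2) ≠ 0 := by
    intro h0
    exact h (by linarith)
  have hΨ := isFrame_frame ((p.1 + q.1) / 2, (p.2.1 + q.2.1) / 2, (p.2.2 + q.2.2) / 2) _ _ _ _ hδ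
  unfold Incident at hpq
  have := (hB.preimage hΨ).eq_univ_of_normal ?_ ?_
  · rwa [preimage_eq_univ_iff, Homeomorph.range_coe, univ_subset_iff] at this
  · intro s
    rw [mem_preimage]
    convert hp s using 1
    ext <;> simp [frame, horizPt]
    · ring
    · ring
    · linear_combination hpq / 2
  · intro s
    rw [mem_preimage]
    convert hq s using 1
    ext <;> simp [frame, horizPt]
    · ring
    · ring
    · linear_combination -hpq / 2

theorem LineClosed.eq_univ_of_skew {B : Set Heis} (hB : LineClosed B) {p q : Heis}
    {a b a' b' : ℝ} (h : a * b' - b * a' ≠ 0) (hp : ∀ t, horizPt p a b t ∈ B)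
    (hq : ∀ t, horizPt q a' b' t ∈ B) (h1 : q.1 = p.1) (h2 : q.2.1 = p.2.1) (hne : q ≠ p) :
    B = univ := by
  have hz : q.2.2 - p.2.2 ≠ 0 := fun h0 ↦ hne (Prod.ext h1 (Prod.ext h2 (by linarith)))
  obtain ⟨t, ht⟩ : ∃ t, t * (a * b' - b * a') = q.2.2 - p.2.2 :=
    ⟨(q.2.2 - p.2.2) / (a * b' - b * a'), by field_simp⟩
  have key : ∀ e : ℝ, e = 1 ∨ e = -1 →
      ∀ r, horizPt (horizPt p a b e) (t * a' - a) (t * b' - b) r ∈ B := by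
    intro e he r
    have he2 : e * e = 1 := by rcases he with rfl | rfl <;> norm_num
    have := hB.mem_horizPt (p := horizPt p a b e) (q := horizPt q a' b' (e * t)) ?_ ?_
      (hp _) (hq _) (e * r)
    · convert this using 1
      ext <;> simp [horizPt, h1, h2]
      · linear_combination (-r * (t * a' - a)) * he2
      · linear_combination (-r * (t * b' - b)) * he2
      · linear_combination (-r * ((p.1 + e * a) * (t * b' - b) -
          (p.2.1 + e * b) * (t * a' - a))) * he2
    · simp [Incident, horizPt, h1, h2]
      linear_combination (-ht) - (a * b' - b * a') * t * he2
    · intro h0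
      have e1 := congrArg Prod.fst h0
      have e2 := congrArg (fun x : Heis ↦ x.2.1) h0
      simp [horizPt, h1, h2] at e1 e2
      apply hz
      rw [← ht]
      linear_combination (-t * a') * (e * e2 - (b - t * b') * he2)
        + (t * b') * (e * e1 - (a - t * a') * he2)
  refine hB.eq_univ_of_parallel ?_ (key 1 (by simp)) (key (-1) (by simp))
  simp [horizPt]
  intro h0
  apply hz
  linear_combination h0 / 2 - ht

theorem LineClosed.snd_eq_zero_of_axes {B : Set Heis} (hB : LineClosed B) (hne : B ≠ univ)
    (hx : ∀ s : ℝ, (s, 0, 0) ∈ B) (hy : ∀ t : ℝ, (0, t, 0) ∈ B) {x y z : ℝ}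
    (h : (x, y, z) ∈ B) (hz : z ≠ 0) : y = 0 := by
  by_contra hy0
  have hs : z / y ≠ 0 := div_ne_zero hz hy0
  obtain ⟨s, hs0, hsy⟩ : ∃ s : ℝ, s ≠ 0 ∧ s * y = z := ⟨z / y, hs, by field_simp⟩
  have hline : ∀ t, horizPt (s, 0, 0) (x - s) y t ∈ B := by
    intro t
    simpa using hB.mem_horizPt (p := (s, 0, 0)) (q := (x, y, z)) (by simp [Incident, hsy])
      (by simp [Ne.symm hy0]) (hx s) h t
  have hyaxis : ∀ c d t : ℝ, horizPt (0, c, 0) 0 d t ∈ B := by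
    intro c d t
    simpa [horizPt] using hy (c + t * d)
  apply hne
  by_cases hxs : x = s
  · subst hxs
    refine hB.eq_univ_of_parallel (p := (0, 0, 0)) ?_ (hyaxis 0 y) (by simpa using hline)
    simp [hs0, hy0]
  · have hxs' : x - s ≠ 0 := sub_ne_zero.2 hxs
    refine hB.eq_univ_of_skew (p := (0, -s / (x - s) * y, 0)) (a := 0) (b := 1)
      (q := horizPt (s, 0, 0) (x - s) y (-s / (x - s))) ?_ (hyaxis _ 1) ?_ ?_ ?_ ?_
      (a' := x - s) (b' := y)
    · simpa using sub_ne_zero.2 (Ne.symm hxs)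
    · intro t
      rw [horizPt_horizPt]
      exact hline _
    · simp [horizPt]
      field_simp
      ring
    · simp [horizPt]
    · simp [horizPt, hs0, hy0, hxs']

theorem LineClosed.eq_zero_of_axes {B : Set Heis} (hB : LineClosed B) (hne : B ≠ univ)
    (hx : ∀ s : ℝ, (s, 0, 0) ∈ B) (hy : ∀ t : ℝ, (0, t, 0) ∈ B)
    (hB2 : ∀ p ∈ B, ∃ q ∈ B, q ≠ p ∧ Incident p q) {p : Heis} (h : p ∈ B) : p.2.2 = 0 := by
  have hsnd : ∀ x y z : ℝ, (x, y, z) ∈ B → z ≠ 0 → y = 0 := fun x y z h hz ↦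
    hB.snd_eq_zero_of_axes hne hx hy h hz
  have hfst : ∀ x y z : ℝ, (x, y, z) ∈ B → z ≠ 0 → x = 0 := by
    intro x y z h hz
    have hδ : (0 : ℝ) * 0 - 1 * 1 ≠ 0 := by norm_num
    refine (hB.preimage (isFrame_frame (0, 0, 0) 0 1 1 0 hδ)).snd_eq_zero_of_axes ?_ ?_ ?_
      (x := y) (z := -z) ?_ (neg_ne_zero.2 hz)
    · rwa [Ne, preimage_eq_univ_iff, Homeomorph.range_coe, univ_subset_iff]
    · intro s; simpa [frame] using hy s
    · intro s; simpa [frame] using hx s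
    · simpa [frame] using h
  obtain ⟨x, y, z⟩ := p
  by_contra hz
  dsimp only at hz
  obtain rfl := hfst _ _ _ h hz
  obtain rfl := hsnd _ _ _ h hz
  obtain ⟨⟨x', y', z'⟩, hq, hne', hinc⟩ := hB2 _ h
  have hz' : z' = z := by simpa [Incident, sub_eq_zero] using hinc
  subst hz'
  obtain rfl := hfst _ _ _ hq hz
  obtain rfl := hsnd _ _ _ hq hz
  exact hne' rfl

theorem LineClosed.exists_plane {B : Set Heis} (hB : LineClosed B) (hne : B ≠ univ)
    (hB2 : ∀ p ∈ B, ∃ q ∈ B, q ≠ p ∧ Incident p q) (hB0 : B.Nonempty) :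
    (∃ α β κ : ℝ, ¬(α = 0 ∧ β = 0) ∧ ∀ p ∈ B, α * p.1 + β * p.2.1 + κ = 0) ∨
      ∃ g, ∀ p ∈ B, Incident g p := by
  have hline : ∀ p ∈ B, ∃ a b : ℝ, ¬(a = 0 ∧ b = 0) ∧ ∀ t, horizPt p a b t ∈ B := by
    intro p hp
    obtain ⟨q, hq, hqp, hinc⟩ := hB2 p hp
    refine ⟨_, _, ?_, hB.mem_horizPt hinc hqp.symm hp hq⟩
    rintro ⟨h1, h2⟩
    apply hqp
    have e1 : q.1 = p.1 := by linarith
    have e2 : q.2.1 = p.2.1 := by linarith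
    refine Prod.ext e1 (Prod.ext e2 ?_)
    rw [Incident, e1, e2] at hinc
    linarith
  obtain ⟨p, hp⟩ := hB0
  obtain ⟨a, b, hab, hpl⟩ := hline p hp
  by_cases hall : ∀ q ∈ B, a * (q.2.1 - p.2.1) - b * (q.1 - p.1) = 0
  · refine .inl ⟨-b, a, b * p.1 - a * p.2.1, fun h ↦ hab ⟨h.2, neg_eq_zero.1 h.1⟩, fun q hq ↦ ?_⟩
    linear_combination hall q hq
  · push Not at hall
    obtain ⟨q, hq, hqp⟩ := hall
    obtain ⟨a', b', hab', hql⟩ := hline q hq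
    have hδ : a * b' - b * a' ≠ 0 := by
      intro hδ
      have hn : a' ^ 2 + b' ^ 2 ≠ 0 := by
        intro h0
        exact hab' ⟨by nlinarith [sq_nonneg a', sq_nonneg b'],
          by nlinarith [sq_nonneg a', sq_nonneg b']⟩
      refine hne (hB.eq_univ_of_parallel hqp hpl fun t ↦ ?_)
      obtain ⟨c, hc⟩ : ∃ c : ℝ, c * (a' ^ 2 + b' ^ 2) = a * a' + b * b' :=
        ⟨(a * a' + b * b') / (a' ^ 2 + b' ^ 2), by field_simp⟩
      have ha : a = c * a' := mul_left_cancel₀ hn (by linear_combination b' * hδ - a' * hc)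
      have hb : b = c * b' := mul_left_cancel₀ hn (by linear_combination -a' * hδ - b' * hc)
      convert hql (t * c) using 1
      rw [ha, hb]
      ext <;> simp only [horizPt] <;> ring
    obtain ⟨s, hs⟩ : ∃ s : ℝ, s * (a * b' - b * a') = (q.1 - p.1) * b' - (q.2.1 - p.2.1) * a' :=
      ⟨_, div_mul_cancel₀ _ hδ⟩
    obtain ⟨t, ht⟩ : ∃ t : ℝ, t * (a * b' - b * a') = (q.1 - p.1) * b - (q.2.1 - p.2.1) * a :=
      ⟨_, div_mul_cancel₀ _ hδ⟩
    set g := horizPt p a b s with hg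
    have hgl : ∀ r, horizPt g a b r ∈ B := fun r ↦ by
      rw [hg, horizPt_horizPt]; exact hpl _
    have hgl' : ∀ r, horizPt g a' b' r ∈ B := by
      have hgeq : horizPt q a' b' t = g := by
        by_contra hgne
        refine hne (hB.eq_univ_of_skew hδ hgl (q := horizPt q a' b' t) (fun r ↦ ?_) ?_ ?_ hgne)
        · rw [horizPt_horizPt]; exact hql _
        · simp only [hg, horizPt]
          refine mul_left_cancel₀ hδ ?_
          linear_combination a' * ht - a * hs
        · simp only [hg, horizPt]
          refine mul_left_cancel₀ hδ ?_
          linear_combination b' * ht - b * hs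
      intro r
      rw [← hgeq, horizPt_horizPt]
      exact hql _
    clear_value g
    right
    refine ⟨g, fun r hr ↦ ?_⟩
    set Ψ := frame g a b a' b' hδ with hΨdef
    have hΨ : IsFrame Ψ := isFrame_frame ..
    have h0 : Ψ (0, 0, 0) = g := by ext <;> simp [hΨdef, frame]
    have := (hB.preimage hΨ).eq_zero_of_axes ?_ ?_ ?_ ?_ (p := Ψ.symm r) (by simpa using hr)
    · rw [← h0, ← Ψ.apply_symm_apply r, hΨ.2]
      simpa [Incident] using this
    · rwa [Ne, preimage_eq_univ_iff, Homeomorph.range_coe, univ_subset_iff]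
    · intro s
      rw [mem_preimage]
      convert hgl s using 1
      ext <;> simp [hΨdef, frame, horizPt]
      ring
    · intro s
      rw [mem_preimage]
      convert hgl' s using 1
      ext <;> simp [hΨdef, frame, horizPt]
      ring
    · intro p hp
      obtain ⟨q, hq, hqp, hinc⟩ := hB2 _ hp
      refine ⟨Ψ.symm q, by simpa using hq, ?_, ?_⟩
      · rintro rfl; simp at hqp
      · rw [← hΨ.2]; simpa using hinc

theorem HorizConvex.exists_ray {E : Set Heis} (hE : HorizConvex E) (y z : ℝ) :
    ∃ n : ℕ, (∀ s : ℝ, n ≤ s → (s, y, z - s * y) ∈ E) ∨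
      ∀ s : ℝ, n ≤ s → (s, y, z - s * y) ∈ Eᶜ := by
  have hbet : ∀ F : Set Heis, HorizConvex F → ∀ s₁ s s₂ : ℝ, s₁ ≤ s → s < s₂ →
      (s₁, y, z - s₁ * y) ∈ F → (s₂, y, z - s₂ * y) ∈ F → (s, y, z - s * y) ∈ F := by
    intro F hF s₁ s s₂ h1 h2 m1 m2
    have hpos : 0 < s₂ - s₁ := by linarith
    convert hF _ _ (by simp [Incident]) m1 m2 ((s - s₁) / (s₂ - s₁))
      (div_nonneg (by linarith) hpos.le) (by rw [div_le_one hpos]; linarith) using 1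
    ext <;> simp <;> field_simp <;> ring
  by_cases hub : ∃ c : ℝ, ∀ s, c ≤ s → (s, y, z - s * y) ∈ Eᶜ
  · obtain ⟨c, hc⟩ := hub
    obtain ⟨n, hn⟩ := exists_nat_ge c
    exact ⟨n, .inr fun s hs ↦ hc s (hn.trans hs)⟩
  · push Not at hub
    obtain ⟨s₁, -, hs₁⟩ := hub 0
    obtain ⟨n, hn⟩ := exists_nat_ge s₁
    refine ⟨n, .inl fun s hs ↦ ?_⟩
    obtain ⟨s₂, hs₂, hs₂'⟩ := hub (s + 1)
    exact hbet E hE s₁ s s₂ (hn.trans hs) (by linarith) (not_not.1 hs₁) (not_not.1 hs₂')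

theorem HorizConvex.interior_nonempty_of_vertical_normal {E : Set Heis} (hE : HorizConvex E)
    (h0 : ∀ z : ℝ, -1 ≤ z → z ≤ 2 → (0, 0, z) ∈ E) (h1 : ∀ z : ℝ, -1 ≤ z → z ≤ 2 → (1, 0, z) ∈ E)
    (h2 : ∀ z : ℝ, -1 ≤ z → z ≤ 2 → (0, 1, z) ∈ E) : (interior E).Nonempty := by
  have ho : IsOpen {q : Heis | 0 < q.1 ∧ 0 < q.2.1 ∧ q.1 + q.2.1 < 1 ∧ 0 < q.2.2 ∧ q.2.2 < 1} := by
    refine .and ?_ (.and ?_ (.and ?_ (.and ?_ ?_))) <;>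
      exact isOpen_lt (by fun_prop) (by fun_prop)
  refine ⟨(1 / 4, 1 / 4, 1 / 2), interior_maximal ?_ ho (by norm_num)⟩
  rintro ⟨x, y, z⟩ ⟨hx, hy, hxy, hz, hz1⟩
  dsimp only at hx hy hxy hz hz1
  have hpos : 0 < x + y := by linarith
  have hy0 : 0 ≤ y / (x + y) := by positivity
  have hy1 : y / (x + y) ≤ 1 := by rw [div_le_one hpos]; linarith
  have hm := hE _ _ (by simp [Incident]) (h1 (z - y / (x + y)) (by linarith) (by linarith))
    (h2 (z - y / (x + y) + 1) (by linarith) (by linarith)) _ hy0 hy1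
  convert hE (0, 0, z) _ ?_ (h0 z (by linarith) (by linarith)) hm (x + y) hpos.le hxy.le using 1
  · ext <;> simp <;> field_simp
    ring
  · simp [Incident]

theorem HorizConvex.interior_nonempty_of_vertical {E : Set Heis} (hE : HorizConvex E)
    {ζ h : ℝ} (hh : 0 < h) {v₀ : ℝ × ℝ}
    (hv₀ : ∀ᶠ v in 𝓝 v₀, v ∈ closure {v : ℝ × ℝ | ∀ z, |z - ζ| ≤ h → (v.1, v.2, z) ∈ E}) :
    (interior E).Nonempty := by
  set G := {v : ℝ × ℝ | ∀ z, |z - ζ| ≤ h → (v.1, v.2, z) ∈ E} with hG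
  obtain ⟨N, hNG, hN, hvN⟩ := eventually_nhds_iff.1 hv₀
  obtain ⟨⟨x, y⟩, hvN, hvG⟩ := mem_closure_iff.1 (hNG _ hvN) N hN hvN
  set O := {p : (ℝ × ℝ) × (ℝ × ℝ) | (p.1 ∈ N ∧ p.2 ∈ N) ∧
    2 * |(p.1.1 - x) * (p.2.2 - y) - (p.1.2 - y) * (p.2.1 - x)| < h / 2 ∧
    |x * (p.1.2 - y) - y * (p.1.1 - x)| < h / 2 ∧
    |x * (p.2.2 - y) - y * (p.2.1 - x)| < h / 2} with hO
  have hOo : IsOpen O := by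
    refine .and (.and (hN.preimage continuous_fst) (hN.preimage continuous_snd))
      (.and ?_ (.and ?_ ?_)) <;> exact isOpen_lt (by fun_prop) (by fun_prop)
  have hD : IsOpen {p : (ℝ × ℝ) × (ℝ × ℝ) |
      (p.1.1 - x) * (p.2.2 - y) - (p.1.2 - y) * (p.2.1 - x) ≠ 0} :=
    isOpen_ne_fun (by fun_prop) (by fun_prop)
  have hcont : Continuous fun ε : ℝ ↦ (((x + ε, y), (x, y + ε)) : (ℝ × ℝ) × (ℝ × ℝ)) := by fun_prop
  have hev : ∀ᶠ ε in 𝓝 (0 : ℝ), ((x + ε, y), (x, y + ε)) ∈ O :=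
    hcont.continuousAt.eventually_mem (hOo.mem_nhds (by simp [hO, hvN, hh]))
  obtain ⟨ε, hεO, hε⟩ := ((hev.filter_mono nhdsWithin_le_nhds).and
    (self_mem_nhdsWithin : {0}ᶜ ∈ 𝓝[≠] (0 : ℝ))).exists
  have hcl : ((x + ε, y), (x, y + ε)) ∈ closure (G ×ˢ G) := by
    rw [closure_prod_eq]
    exact ⟨hNG _ hεO.1.1, hNG _ hεO.1.2⟩
  obtain ⟨⟨⟨x₂, y₂⟩, ⟨x₃, y₃⟩⟩, ⟨⟨-, hb, hb2, hb3⟩, hδ⟩, hG2, hG3⟩ :=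
    mem_closure_iff.1 hcl _ (hOo.inter hD) ⟨hεO, by simpa using hε⟩
  dsimp only [mem_ofPred_eq] at hb hb2 hb3 hδ hG2 hG3
  have hΨ := isFrame_frame (x, y, ζ) _ _ _ _ hδ
  set Ψ := frame (x, y, ζ) _ _ _ _ hδ with hΨdef
  have hz : ∀ z c : ℝ, -1 ≤ z → z ≤ 2 → |c| < h / 2 →
      |ζ + ((x₂ - x) * (y₃ - y) - (y₂ - y) * (x₃ - x)) * z + c - ζ| ≤ h := by
    intro z c h1 h2 hc
    have hz2 : |z| ≤ 2 := abs_le.2 ⟨by linarith, h2⟩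
    have := mul_le_mul_of_nonneg_left hz2
      (abs_nonneg ((x₂ - x) * (y₃ - y) - (y₂ - y) * (x₃ - x)))
    rw [← abs_mul] at this
    rw [show ∀ a b : ℝ, ζ + a + b - ζ = a + b by intros; ring]
    linarith [abs_add_le (((x₂ - x) * (y₃ - y) - (y₂ - y) * (x₃ - x)) * z) c]
  suffices h : (interior (Ψ ⁻¹' E)).Nonempty by
    obtain ⟨p, hp⟩ := h
    exact ⟨_, mem_interior_preimage.1 hp⟩
  refine (hE.preimage hΨ).interior_nonempty_of_vertical_normal
    (fun z h1 h2 ↦ ?_) (fun z h1 h2 ↦ ?_) (fun z h1 h2 ↦ ?_)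
  · rw [mem_preimage]
    convert hvG _ (hz z 0 h1 h2 (by simpa using hh)) using 1
    ext <;> simp [hΨdef, frame]
  · rw [mem_preimage]
    convert hG2 _ (hz z _ h1 h2 hb2) using 1
    ext <;> simp [hΨdef, frame]
    ring
  · rw [mem_preimage]
    convert hG3 _ (hz z _ h1 h2 hb3) using 1
    ext <;> simp [hΨdef, frame]
    ring

/-- Parameters of the lines in the first coordinate direction which lie in `E` beyond time `n`. -/
def rays (E : Set Heis) (n : ℕ) : Set (ℝ × ℝ) :=
  {w | ∀ s : ℝ, n ≤ s → (s, w.1, w.2 - s * w.1) ∈ E}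

theorem HorizConvex.mem_of_rays {E : Set Heis} (hE : HorizConvex E) {n : ℕ} {w₁ w₂ : ℝ × ℝ}
    (h₁ : w₁ ∈ rays E n) (h₂ : w₂ ∈ rays E n) (hlt : w₁.1 < w₂.1) {σ z : ℝ}
    (hσ : σ * (2 * (w₂.1 - w₁.1)) = w₂.2 - w₁.2)
    (hz : |z - ((w₁.2 + w₂.2) / 2 - σ * ((w₁.1 + w₂.1) / 2))| ≤ (σ - n) * ((w₂.1 - w₁.1) / 2)) :
    (σ, (w₁.1 + w₂.1) / 2, z) ∈ E := by
  have hpos : 0 < (w₂.1 - w₁.1) / 2 := by linarith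
  obtain ⟨τ, hτ⟩ : ∃ τ, τ * ((w₂.1 - w₁.1) / 2) =
      z - ((w₁.2 + w₂.2) / 2 - σ * ((w₁.1 + w₂.1) / 2)) := ⟨_, div_mul_cancel₀ _ hpos.ne'⟩
  rw [← hτ, abs_mul, abs_of_pos hpos] at hz
  have hτ' := abs_le.1 (le_of_mul_le_mul_right hz hpos)
  convert hE _ _ ?_ (h₁ (σ + τ) (by linarith)) (h₂ (σ - τ) (by linarith)) (1 / 2) (by norm_num)
    (by norm_num) using 1
  · ext <;> simp
    · ring
    · ring
    · linear_combination -hτ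
  · simp only [Incident]
    linear_combination -hσ

theorem HorizConvex.interior_nonempty_of_rays {E : Set Heis} (hE : HorizConvex E) {n : ℕ}
    (h : (interior (closure (rays E n))).Nonempty) : (interior E).Nonempty := by
  obtain ⟨w, hw⟩ := h
  obtain ⟨⟨y, z⟩, hI, hyz⟩ := mem_closure_iff.1 (interior_subset hw) _ isOpen_interior hw
  set I := interior (closure (rays E n)) with hIdef
  have hIo : IsOpen I := isOpen_interior
  obtain ⟨e, heI, he⟩ : ∃ e : ℝ, (y + 2 * e, z + 4 * (n + 1) * e) ∈ I ∧ 0 < e := by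
    have hc : Continuous fun e : ℝ ↦ ((y + 2 * e, z + 4 * (n + 1) * e) : ℝ × ℝ) := by fun_prop
    have hev : ∀ᶠ e in 𝓝 (0 : ℝ), (y + 2 * e, z + 4 * (n + 1) * e) ∈ I :=
      hc.continuousAt.eventually_mem (hIo.mem_nhds (by simpa using hI))
    exact ((hev.filter_mono nhdsWithin_le_nhds).and
      (self_mem_nhdsWithin : Ioi 0 ∈ 𝓝[>] (0 : ℝ))).exists
  set g : ℝ × ℝ → ℝ × ℝ := fun v ↦ (2 * v.2 - y, z + 4 * v.1 * (v.2 - y)) with hg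
  have hgc : Continuous g := by fun_prop
  set c : ℝ × ℝ → ℝ := fun v ↦ z + 2 * v.1 * (v.2 - y) - v.1 * v.2 with hcdef
  have hcc : Continuous c := by fun_prop
  set k : ℝ × ℝ → ℝ × ℝ := fun w ↦ ((w.2 - z) / (2 * (w.1 - y)), (y + w.1) / 2) with hk
  set v₀ : ℝ × ℝ := (n + 1, y + e) with hv₀
  set O := {v : ℝ × ℝ | y < v.2 ∧ |c v - c v₀| < e / 8 ∧ 3 * e / 4 < (v.1 - n) * (v.2 - y)} with hO
  have hOo : IsOpen O := by
    refine .and ?_ (.and ?_ ?_) <;> exact isOpen_lt (by fun_prop) (by fun_prop)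
  have hvO : v₀ ∈ O := by
    simp [hO, hv₀, he]
    linarith
  have hgv : g v₀ ∈ I := by
    convert heI using 1
    simp [hg, hv₀]
    ring_nf
  refine hE.interior_nonempty_of_vertical (v₀ := v₀) (ζ := c v₀) (h := e / 2) (by positivity) ?_
  filter_upwards [hOo.mem_nhds hvO, (hIo.preimage hgc).mem_nhds hgv] with v hv hvI
  have hne : 2 * ((g v).1 - y) ≠ 0 := by
    have := hv.1
    simp only [hg]
    intro h0
    linarith
  have hkg : k (g v) = v := by
    simp only [hg] at hne
    ext <;> simp only [hg, hk]
    · rw [div_eq_iff hne]; ring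
    · ring
  have hkc : Tendsto k (𝓝 (g v)) (𝓝 v) := by
    have : ContinuousAt k (g v) := by
      simp only [hk]
      fun_prop (disch := exact hne)
    rwa [ContinuousAt, hkg] at this
  have hfreq := mem_closure_iff_frequently.1 (interior_subset hvI)
  rw [mem_closure_iff_frequently]
  refine hkc.frequently ((hfreq.and_eventually (hkc.eventually_mem (hOo.mem_nhds hv))).mono ?_)
  rintro w ⟨hwr, h1, h2, h3⟩ ζ hζ
  simp only [hk] at h1
  have hyw : y < w.1 := by linarith
  have hwy : 2 * (w.1 - y) ≠ 0 := by
    intro h0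
    linarith
  refine hE.mem_of_rays hyz hwr hyw (div_mul_cancel₀ _ hwy) ?_
  have hσ : (k w).1 * (2 * (w.1 - y)) = w.2 - z := div_mul_cancel₀ _ hwy
  have e1 : (z + w.2) / 2 - (k w).1 * ((y + w.1) / 2) = c (k w) := by
    rw [hcdef]
    dsimp only
    rw [show (k w).2 = (y + w.1) / 2 from rfl]
    linear_combination -hσ / 2
  have e2 : ((k w).1 - n) * ((w.1 - y) / 2) = ((k w).1 - n) * ((k w).2 - y) := by
    rw [show (k w).2 = (y + w.1) / 2 from rfl]
    ring
  change |ζ - ((z + w.2) / 2 - (k w).1 * ((y + w.1) / 2))| ≤ ((k w).1 - n) * ((w.1 - y) / 2)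
  rw [e1, e2]
  have := abs_sub_le ζ (c v₀) (c (k w))
  rw [abs_sub_comm (c v₀)] at this
  linarith

theorem HorizConvex.interior_nonempty_or {E : Set Heis} (hE : HorizConvex E)
    (hE' : HorizConvex Eᶜ) : (interior E).Nonempty ∨ (interior Eᶜ).Nonempty := by
  obtain ⟨n | n, hn⟩ := nonempty_interior_of_iUnion_of_closed
    (f := Sum.elim (fun n ↦ closure (rays E n)) (fun n ↦ closure (rays Eᶜ n)))
    (by rintro (n | n) <;> exact isClosed_closure)
    (eq_univ_of_forall fun w ↦ by
      obtain ⟨n, h | h⟩ := hE.exists_ray w.1 w.2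
      · exact mem_iUnion.2 ⟨.inl n, subset_closure h⟩
      · exact mem_iUnion.2 ⟨.inr n, subset_closure h⟩)
  · exact .inl (hE.interior_nonempty_of_rays hn)
  · exact .inr (hE'.interior_nonempty_of_rays hn)

/-- Exponential coordinates on the Heisenberg group, with the central coordinate doubled. -/
def expCoord : Heis ≃ₜ Heis where
  toFun p := (p.1, p.2.1, 2 * p.2.2 - p.1 * p.2.1)
  invFun p := (p.1, p.2.1, (p.2.2 + p.1 * p.2.1) / 2)
  left_inv p := by ext <;> simp
  right_inv p := by ext <;> simp; ring
  continuous_toFun := by fun_prop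
  continuous_invFun := by fun_prop

theorem horizConvex_of_isPreconnected {E : Set Heis}
    (hE : ∀ L, IsLine L → IsPreconnected (L ∩ E)) : HorizConvex (expCoord.symm ⁻¹' E) := by
  intro p q hpq hp hq t ht0 ht1
  by_cases hab : q.1 - p.1 = 0 ∧ q.2.1 - p.2.1 = 0
  · have h : q = p := by
      have e1 : q.1 = p.1 := sub_eq_zero.1 hab.1
      have e2 : q.2.1 = p.2.1 := sub_eq_zero.1 hab.2
      refine Prod.ext e1 (Prod.ext e2 ?_)
      rw [Incident, e1, e2] at hpq
      linarith
    simpa [h] using hp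
  set a := q.1 - p.1 with ha
  set b := q.2.1 - p.2.1 with hb
  have hn : a ^ 2 + b ^ 2 ≠ 0 := fun h0 ↦
    hab ⟨by nlinarith [sq_nonneg a, sq_nonneg b], by nlinarith [sq_nonneg a, sq_nonneg b]⟩
  have hL (s : ℝ) : hMul (expCoord.symm p) (s * a, s * b, s ^ 2 * a * b / 2) =
      expCoord.symm (p + s • (q - p)) := by
    ext
    · simp [hMul, expCoord, ha]
    · simp [hMul, expCoord, hb]
    · simp only [Incident] at hpq
      simp [hMul, expCoord, ha, hb]
      linear_combination -s / 2 * hpq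
  set φ : Heis → ℝ := fun x ↦ a * x.1 + b * x.2.1 with hφ
  have hφL (s : ℝ) : φ (expCoord.symm (p + s • (q - p))) =
      a * p.1 + b * p.2.1 + s * (a ^ 2 + b ^ 2) := by
    simp [hφ, expCoord, ← ha, ← hb]
    ring
  have hord := ((hE (hLine (expCoord.symm p) a b) ⟨_, _, _, hab, rfl⟩).image φ
    (by fun_prop)).ordConnected
  have hmem (s : ℝ) (hs : p + s • (q - p) ∈ expCoord.symm ⁻¹' E) :
      a * p.1 + b * p.2.1 + s * (a ^ 2 + b ^ 2) ∈ φ '' (hLine (expCoord.symm p) a b ∩ E) :=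
    ⟨_, ⟨⟨s, (hL s).symm⟩, hs⟩, hφL s⟩
  have hpos : 0 < a ^ 2 + b ^ 2 := lt_of_le_of_ne (by positivity) hn.symm
  obtain ⟨x, ⟨⟨s, rfl⟩, hxE⟩, hx⟩ := hord.out (hmem 0 (by simpa using hp))
    (hmem 1 (by simpa using hq))
    (show a * p.1 + b * p.2.1 + t * (a ^ 2 + b ^ 2) ∈ Icc _ _ from
      ⟨by gcongr, by gcongr⟩)
  rw [hL, hφL, add_right_inj, mul_left_inj' hn] at hx
  rw [hL, hx] at hxE
  exact hxE

/-- The affine function with gradient `v` and constant term `κ`. -/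
def affineFun (v : Heis) (κ : ℝ) (p : Heis) : ℝ :=
  v.1 * p.1 + v.2.1 * p.2.1 + v.2.2 * p.2.2 + κ

theorem affineFun_neg (v : Heis) (κ : ℝ) (p : Heis) :
    affineFun (-v) (-κ) p = -affineFun v κ p := by
  simp [affineFun]
  ring

theorem affineFun_add_smul (v : Heis) (κ : ℝ) (p : Heis) (t : ℝ) :
    affineFun v κ (p + t • v) = affineFun v κ p + t * (v.1 ^ 2 + v.2.1 ^ 2 + v.2.2 ^ 2) := by
  simp [affineFun]
  ring

theorem normSq_pos {v : Heis} (hv : v ≠ 0) : 0 < v.1 ^ 2 + v.2.1 ^ 2 + v.2.2 ^ 2 := by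
  refine lt_of_le_of_ne (by positivity) fun h ↦ hv ?_
  ext <;> simp only [Prod.fst_zero, Prod.snd_zero] <;>
    nlinarith [sq_nonneg v.1, sq_nonneg v.2.1, sq_nonneg v.2.2]

theorem continuous_affineFun (v : Heis) (κ : ℝ) : Continuous (affineFun v κ) := by
  unfold affineFun
  fun_prop

theorem isPreconnected_affineFun_pos (v : Heis) (κ : ℝ) :
    IsPreconnected {p | 0 < affineFun v κ p} := by
  refine Convex.isPreconnected fun p hp q hq a b ha hb hab ↦ ?_
  have : affineFun v κ (a • p + b • q) = a * affineFun v κ p + b * affineFun v κ q := by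
    simp [affineFun]
    linear_combination -κ * hab
  rw [mem_ofPred_eq, this]
  rcases ha.eq_or_lt with rfl | ha
  · obtain rfl : b = 1 := by linarith
    simpa using hq
  · exact add_pos_of_pos_of_nonneg (mul_pos ha hp) (mul_nonneg hb (le_of_lt hq))

theorem subset_closure_affineFun_pos {v : Heis} (hv : v ≠ 0) (κ : ℝ) :
    {p | 0 ≤ affineFun v κ p} ⊆ closure {p | 0 < affineFun v κ p} := by
  intro p hp
  have hc : Tendsto (fun t : ℝ ↦ p + t • v) (𝓝[>] 0) (𝓝 p) := by
    have : Continuous fun t : ℝ ↦ p + t • v := by fun_prop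
    simpa using (this.tendsto 0).mono_left nhdsWithin_le_nhds
  refine mem_closure_of_tendsto hc ?_
  filter_upwards [self_mem_nhdsWithin] with t ht
  rw [affineFun_add_smul]
  exact add_pos_of_nonneg_of_pos hp (mul_pos ht (normSq_pos hv))

theorem IsOpen.exists_affineFun_ne_zero {U : Set Heis} (hU : IsOpen U) (hU0 : U.Nonempty)
    {v : Heis} (hv : v ≠ 0) (κ : ℝ) : ∃ p ∈ U, affineFun v κ p ≠ 0 := by
  obtain ⟨p, hp⟩ := hU0
  by_cases h : affineFun v κ p = 0
  · obtain ⟨q, hq, hq'⟩ := mem_closure_iff.1 (subset_closure_affineFun_pos hv κ h.ge) U hU hp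
    exact ⟨q, hq, ne_of_gt hq'⟩
  · exact ⟨p, hp, h⟩

theorem exists_affineFun_of_bdry {E : Set Heis} {v : Heis} (hv : v ≠ 0) {κ : ℝ}
    (h : ∀ p ∈ bdry E, affineFun v κ p = 0) (h1 : (interior E).Nonempty)
    (h2 : (interior Eᶜ).Nonempty) :
    ∃ v κ, v ≠ 0 ∧ {p | 0 < affineFun v κ p} ⊆ E ∧ E ⊆ {p | 0 ≤ affineFun v κ p} := by
  have hside (w : Heis) (μ : ℝ) (hw : ∀ p ∈ bdry E, affineFun w μ p = 0) :
      {p | 0 < affineFun w μ p} ⊆ interior E ∨ {p | 0 < affineFun w μ p} ⊆ interior Eᶜ := by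
    refine (isPreconnected_affineFun_pos w μ).subset_or_subset isOpen_interior isOpen_interior
      (disjoint_compl_right.mono interior_subset interior_subset) fun p hp ↦ ?_
    by_contra hpb
    exact ne_of_gt hp (hw p hpb)
  have hneg : {p | 0 < affineFun (-v) (-κ) p} = {p | affineFun v κ p < 0} := by
    ext p
    simp [affineFun_neg]
  have key := hside (-v) (-κ) fun p hp ↦ by rw [affineFun_neg, h p hp, neg_zero]
  rcases hside v κ h with hp | hp <;> rcases key with hn | hn
  · obtain ⟨q, hq, hq'⟩ := isOpen_interior.exists_affineFun_ne_zero h2 hv κ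
    refine absurd (interior_subset ?_) (interior_subset hq)
    rw [hneg] at hn
    exact hq'.lt_or_gt.elim (fun h ↦ hn h) fun h ↦ hp h
  · rw [hneg] at hn
    refine ⟨v, κ, hv, hp.trans interior_subset, fun p hpE ↦ ?_⟩
    by_contra hlt
    rw [mem_ofPred_eq, not_le] at hlt
    exact interior_subset (hn hlt) hpE
  · refine ⟨-v, -κ, neg_ne_zero.2 hv, hn.trans interior_subset, fun p hpE ↦ ?_⟩
    by_contra hlt
    rw [mem_ofPred_eq, not_le] at hlt
    rw [affineFun_neg, neg_lt_zero] at hlt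
    exact interior_subset (hp hlt) hpE
  · obtain ⟨q, hq, hq'⟩ := isOpen_interior.exists_affineFun_ne_zero h1 hv κ
    refine absurd (interior_subset hq) (show q ∈ Eᶜ from interior_subset ?_)
    rw [hneg] at hn
    exact hq'.lt_or_gt.elim (fun h ↦ hn h) fun h ↦ hp h

theorem HorizConvex.eq_empty_or_eq_univ_or {E : Set Heis} (hE : HorizConvex E)
    (hE' : HorizConvex Eᶜ) : E = ∅ ∨ E = univ ∨
      ∃ v κ, v ≠ 0 ∧ {p | 0 < affineFun v κ p} ⊆ E ∧ E ⊆ {p | 0 ≤ affineFun v κ p} := by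
  rcases (interior E).eq_empty_or_nonempty with h1 | h1
  · left
    rw [← compl_univ_iff]
    refine hE'.eq_univ_of_interior_compl_eq_empty ?_ (by rwa [compl_compl])
    exact (hE.interior_nonempty_or hE').resolve_left (by simp [h1])
  rcases (interior Eᶜ).eq_empty_or_nonempty with h2 | h2
  · exact .inr (.inl (hE.eq_univ_of_interior_compl_eq_empty h1 h2))
  right; right
  have hb0 : (bdry E).Nonempty := by
    by_contra hb
    rw [not_nonempty_iff_eq_empty, bdry, compl_empty_iff] at hb
    obtain ⟨x, -, hx, hx'⟩ := isPreconnected_univ (interior E) (interior Eᶜ) isOpen_interior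
      isOpen_interior hb.ge (by simpa using h1) (by simpa using h2)
    exact interior_subset hx' (interior_subset hx)
  have hbne : bdry E ≠ univ := by
    obtain ⟨x, hx⟩ := h1
    exact fun h ↦ (h ▸ mem_univ x : x ∈ bdry E) (.inl hx)
  obtain ⟨α, β, κ, hαβ, h⟩ | ⟨g, h⟩ := (hE.lineClosed_bdry hE').exists_plane hbne
    (fun p hp ↦ hE.exists_incident_bdry hE' hp) hb0
  · refine exists_affineFun_of_bdry (v := (α, β, 0)) (κ := κ) ?_ (fun p hp ↦ ?_) h1 h2
    · simpa [Prod.ext_iff] using hαβ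
    · simpa [affineFun] using h p hp
  · refine exists_affineFun_of_bdry (v := (g.2.1, -g.1, 1)) (κ := -g.2.2) ?_ (fun p hp ↦ ?_) h1 h2
    · simp [Prod.ext_iff]
    · have := h p hp
      simp only [Incident] at this
      simp only [affineFun]
      linarith

theorem mem_horizPlane_iff {g p : Heis} :
    p ∈ horizPlane g ↔ Incident (expCoord g) (expCoord p) := by
  constructor
  · rintro ⟨_, ⟨k, a, b, -, rfl⟩, ⟨s, rfl⟩, ⟨t, rfl⟩⟩
    simp [Incident, expCoord, hMul]
    ring
  · intro h
    simp [Incident, expCoord] at h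
    by_cases hab : p.1 - g.1 = 0 ∧ p.2.1 - g.2.1 = 0
    · have e1 : p.1 = g.1 := sub_eq_zero.1 hab.1
      have e2 : p.2.1 = g.2.1 := sub_eq_zero.1 hab.2
      rw [e1, e2] at h
      obtain rfl : p = g := Prod.ext e1 (Prod.ext e2 (by linarith))
      refine ⟨_, ⟨p, 1, 0, by simp, rfl⟩, ⟨0, ?_⟩, ⟨0, ?_⟩⟩ <;> ext <;> simp [hMul]
    · refine ⟨_, ⟨g, _, _, hab, rfl⟩, ⟨0, ?_⟩, ⟨1, ?_⟩⟩ <;> ext <;> simp [hMul]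
      linarith

theorem isPlane_affineFun {v : Heis} (hv : v ≠ 0) (κ : ℝ) :
    IsPlane {p | affineFun v κ (expCoord p) = 0} := by
  obtain ⟨α, β, γ⟩ := v
  by_cases hγ : γ = 0
  · subst hγ
    have hn : α ^ 2 + β ^ 2 ≠ 0 := by
      intro h
      apply hv
      ext <;> simp only [Prod.fst_zero, Prod.snd_zero] <;> nlinarith [sq_nonneg α, sq_nonneg β]
    refine .inl ⟨_, ⟨(-κ * α / (α ^ 2 + β ^ 2), -κ * β / (α ^ 2 + β ^ 2)), (-β, α), ?_, rfl⟩, ?_⟩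
    · intro h
      simp only [Prod.mk_eq_zero, neg_eq_zero] at h
      exact hn (by simp [h.1, h.2])
    · ext ⟨x, y, z⟩
      simp only [affineFun, expCoord, hPi, mem_ofPred_eq, mem_preimage, Prod.ext_iff]
      simp
      constructor
      · intro h
        refine ⟨(α * y - β * x) / (α ^ 2 + β ^ 2), ?_, ?_⟩ <;> field_simp
        · linear_combination α * h
        · linear_combination β * h
      · rintro ⟨t, rfl, rfl⟩
        field_simp
        ring
  · refine .inr ⟨expCoord.symm (-β / γ, α / γ, -κ / γ), ?_⟩
    ext p
    rw [mem_horizPlane_iff, expCoord.apply_symm_apply]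
    simp only [mem_ofPred_eq, affineFun, Incident]
    rw [← mul_right_inj' hγ (b := _ - _)]
    field_simp
    constructor <;> intro h <;> linarith

theorem isHalfSpace_affineFun_pos {v : Heis} (hv : v ≠ 0) (κ : ℝ) :
    IsHalfSpace (expCoord ⁻¹' {p | 0 < affineFun v κ p}) := by
  obtain ⟨x, hx⟩ : ∃ x, 0 < affineFun v κ (expCoord x) := by
    refine ⟨expCoord.symm
      (0 + ((1 - affineFun v κ 0) / (v.1 ^ 2 + v.2.1 ^ 2 + v.2.2 ^ 2)) • v), ?_⟩
    rw [expCoord.apply_symm_apply, affineFun_add_smul, div_mul_cancel₀ _ (normSq_pos hv).ne']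
    linarith
  have hc := (continuous_affineFun v κ).comp expCoord.continuous
  refine ⟨_, x, isPlane_affineFun hv κ, hx.ne', Subset.antisymm ?_ ?_⟩
  · refine IsPreconnected.subset_connectedComponentIn ?_ hx fun p hp ↦ ne_of_gt hp
    exact (expCoord.isPreconnected_preimage).2 (isPreconnected_affineFun_pos v κ)
  · refine isPreconnected_connectedComponentIn.subset_left_of_subset_union
      (isOpen_lt continuous_const hc) (isOpen_lt hc (continuous_const (y := 0))) ?_ ?_
      ⟨x, mem_connectedComponentIn hx.ne', hx⟩
    · rw [disjoint_left]
      intro p hp hp'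
      rw [mem_preimage, mem_ofPred_eq] at hp
      exact lt_asymm hp hp'
    · exact (connectedComponentIn_subset _ _).trans fun p hp ↦ (lt_or_gt_of_ne hp).symm

/-- A precisely monotone subset of the Heisenberg group is `∅`, all of `H`, or lies
between a half-space and its closure. -/
theorem statement8 (E : Set Heis) (hE : IsPreciselyMonotone E) :
    E = ∅ ∨ E = Set.univ ∨
      ∃ C : Set Heis, IsHalfSpace C ∧ C ⊆ E ∧ E ⊆ closure C := by
  have hE₁ := horizConvex_of_isPreconnected fun L hL ↦ (hE L hL).1
  have hE₂ := horizConvex_of_isPreconnected fun L hL ↦ (hE L hL).2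
  have hpre : E = expCoord ⁻¹' (expCoord.symm ⁻¹' E) := by
    ext p
    simp
  rw [hpre]
  rcases hE₁.eq_empty_or_eq_univ_or hE₂ with h | h | ⟨v, κ, hv, h1, h2⟩
  · left
    rw [h, preimage_empty]
  · right; left
    rw [h, preimage_univ]
  · refine .inr (.inr ⟨_, isHalfSpace_affineFun_pos hv κ, preimage_mono h1, ?_⟩)
    rw [← expCoord.preimage_closure]
    exact preimage_mono (h2.trans (subset_closure_affineFun_pos hv κ))
end
end

section
/- For v = (a,b) ∈ ℝ² set exp(v) := (a, b, ab/2) ∈ H, and define Γ : H × ℝ² × ℝ² → H by Γ(x, v₁, v₂) = x·exp(v₁)·exp(v₂). Then Γ is smooth, and for every x ∈ H the map Γ_x := Γ(x,·,·) : ℝ² × ℝ² → H is a submersion at every point (v₁,v₂) with v₁ + v₂ ≠ 0. -/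
open MeasureTheory Set Topology Filter

noncomputable section

/-- `exp(a,b) = (a, b, ab/2)`. -/
def expv (v : ℝ × ℝ) : Heis := (v.1, v.2, v.1 * v.2 / 2)

/-- The derivative of `Γ_x` at `v`, in coordinates. -/
theorem exists_hasFDerivAt_endpoint (x : Heis) (v : (ℝ × ℝ) × (ℝ × ℝ)) :
    ∃ D : ((ℝ × ℝ) × (ℝ × ℝ)) →L[ℝ] Heis,
      HasFDerivAt (fun w : (ℝ × ℝ) × (ℝ × ℝ) => hMul (hMul x (expv w.1)) (expv w.2)) D v ∧
      ∀ w, D w = (w.1.1 + w.2.1, w.1.2 + w.2.2,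
        (v.1.1 * w.1.2 + v.1.2 * w.1.1) / 2 + x.1 * w.1.2 +
          (v.2.1 * w.2.2 + v.2.2 * w.2.1) / 2 + (x.1 + v.1.1) * w.2.2 + v.2.2 * w.1.1) := by
  have ha₁ : HasFDerivAt (fun w : (ℝ × ℝ) × (ℝ × ℝ) => w.1.1) _ v :=
    (hasFDerivAt_fst (𝕜 := ℝ) (p := v)).fst
  have hb₁ : HasFDerivAt (fun w : (ℝ × ℝ) × (ℝ × ℝ) => w.1.2) _ v :=
    (hasFDerivAt_fst (𝕜 := ℝ) (p := v)).snd
  have ha₂ : HasFDerivAt (fun w : (ℝ × ℝ) × (ℝ × ℝ) => w.2.1) _ v :=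
    (hasFDerivAt_snd (𝕜 := ℝ) (p := v)).fst
  have hb₂ : HasFDerivAt (fun w : (ℝ × ℝ) × (ℝ × ℝ) => w.2.2) _ v :=
    (hasFDerivAt_snd (𝕜 := ℝ) (p := v)).snd
  have hc := (((((ha₁.mul hb₁).mul_const 2⁻¹).const_add x.2.2).add (hb₁.const_mul x.1)).add
    ((ha₂.mul hb₂).mul_const 2⁻¹)).add ((ha₁.const_add x.1).mul hb₂)
  refine ⟨_, ((ha₁.const_add x.1).add ha₂).prodMk (((hb₁.const_add x.2.1).add hb₂).prodMk hc),
    fun w => ?_⟩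
  ext <;> simp
  ring

/-- The endpoint map `Γ(x,v₁,v₂) = x·exp(v₁)·exp(v₂)` of broken horizontal lines is
smooth, and `Γ_x` is a submersion at every `(v₁,v₂)` with `v₁ + v₂ ≠ 0`. -/
theorem statement9 :
    ContDiff ℝ (⊤ : ℕ∞) (fun w : Heis × (ℝ × ℝ) × (ℝ × ℝ) =>
      hMul (hMul w.1 (expv w.2.1)) (expv w.2.2)) ∧
    ∀ (x : Heis) (v : (ℝ × ℝ) × (ℝ × ℝ)), v.1 + v.2 ≠ 0 →
      ∃ D : ((ℝ × ℝ) × (ℝ × ℝ)) →L[ℝ] Heis,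
        HasFDerivAt (fun w : (ℝ × ℝ) × (ℝ × ℝ) =>
          hMul (hMul x (expv w.1)) (expv w.2)) D v ∧
        Function.Surjective D := by
  refine ⟨by unfold hMul expv; fun_prop, fun x v hv => ?_⟩
  obtain ⟨D, hD, hD_apply⟩ := exists_hasFDerivAt_endpoint x v
  refine ⟨D, hD, ?_⟩
  rintro ⟨p, q, r⟩
  obtain ⟨⟨a₁, b₁⟩, a₂, b₂⟩ := v
  have hN : (a₁ + a₂) ^ 2 + (b₁ + b₂) ^ 2 ≠ 0 := by
    intro h
    apply hv
    ext
    · simp only [Prod.fst_add, Prod.fst_zero]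
      nlinarith [sq_nonneg (a₁ + a₂), sq_nonneg (b₁ + b₂)]
    · simp only [Prod.snd_add, Prod.snd_zero]
      nlinarith [sq_nonneg (a₁ + a₂), sq_nonneg (b₁ + b₂)]
  obtain ⟨t, ht⟩ : ∃ t, t * ((a₁ + a₂) ^ 2 + (b₁ + b₂) ^ 2) =
      2 * (r - b₂ * p / 2 - a₂ * q / 2 - (x.1 + a₁) * q) := ⟨_, div_mul_cancel₀ _ hN⟩
  refine ⟨((t * (b₁ + b₂), -t * (a₁ + a₂)), p - t * (b₁ + b₂), q + t * (a₁ + a₂)), ?_⟩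
  rw [hD_apply]
  ext
  · simp
  · simp
  · dsimp only
    linear_combination ht / 2
end
end

section
/- Suppose E ⊆ H is precisely monotone, L is a line of H, p ∈ L, and Σ ⊆ E is a C¹ embedded surface in H ≅ ℝ³ which intersects L transversely in a single point q ∈ L∖{p} (i.e. L ∩ Σ = {q} and the tangent plane of Σ at q together with the direction of L spans ℝ³). Then: (1) if p is not in the topological interior of H∖E, the open segment (p,q) ⊂ L (the set of points of L strictly between p and q) is contained in the interior of E; (2) if p ∈ H∖E, the connected component of L∖{q} not containing p is contained in the interior of E. The same statements hold with the roles of E and H∖E exchanged. -/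
open MeasureTheory Set Topology Filter

noncomputable section

/-- The point at time `t` on the horizontal line through `h` with direction `u`. -/
def hPt (h : Heis) (u : ℝ × ℝ) (t : ℝ) : Heis :=
  hMul h (t * u.1, t * u.2, t ^ 2 * u.1 * u.2 / 2)

lemma continuous_hPt : Continuous fun z : (Heis × (ℝ × ℝ)) × ℝ => hPt z.1.1 z.1.2 z.2 := by
  unfold hPt hMul
  fun_prop

lemma isLine_range_hPt (h : Heis) {u : ℝ × ℝ} (hu : u ≠ 0) : IsLine (range (hPt h u)) := by
  refine ⟨h, u.1, u.2, fun h0 => hu (Prod.ext h0.1 h0.2), ?_⟩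
  ext x
  exact ⟨fun ⟨t, ht⟩ => ⟨t, ht.symm⟩, fun ⟨t, ht⟩ => ⟨t, ht.symm⟩⟩

lemma sq_add_sq_pos {u : ℝ × ℝ} (hu : u ≠ 0) : 0 < u.1 ^ 2 + u.2 ^ 2 := by
  by_contra! hle
  exact hu (Prod.ext (by simpa using (by nlinarith [sq_nonneg u.1, sq_nonneg u.2] : u.1 ^ 2 = 0))
    (by simpa using (by nlinarith [sq_nonneg u.1, sq_nonneg u.2] : u.2 ^ 2 = 0)))

lemma mem_of_isPreconnected_range_hPt {A : Set Heis} {h : Heis} {u : ℝ × ℝ} (hu : u ≠ 0)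
    (hA : IsPreconnected (range (hPt h u) ∩ A)) {t₁ t₂ t₃ : ℝ} (h₁₂ : t₁ ≤ t₂) (h₂₃ : t₂ ≤ t₃)
    (h₁ : hPt h u t₁ ∈ A) (h₃ : hPt h u t₃ ∈ A) : hPt h u t₂ ∈ A := by
  have hN := (sq_add_sq_pos hu).ne'
  let f : Heis → ℝ := fun x => ((x.1 - h.1) * u.1 + (x.2.1 - h.2.1) * u.2) / (u.1 ^ 2 + u.2 ^ 2)
  have hf : ∀ t, f (hPt h u t) = t := fun t => by
    simp only [f, hPt, hMul]
    field_simp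
    ring
  have hfc : Continuous f := by fun_prop
  have hord := (hA.image f hfc.continuousOn).ordConnected
  obtain ⟨x, ⟨⟨t, rfl⟩, hx⟩, hxt⟩ := hord.out
    ⟨_, ⟨⟨t₁, rfl⟩, h₁⟩, hf t₁⟩ ⟨_, ⟨⟨t₃, rfl⟩, h₃⟩, hf t₃⟩ ⟨h₁₂, h₂₃⟩
  rw [hf] at hxt
  rwa [← hxt]

lemma IsPreciselyMonotone.mem_of_mem {E : Set Heis} (hE : IsPreciselyMonotone E) {h : Heis}
    {u : ℝ × ℝ} (hu : u ≠ 0) {t₁ t₂ t₃ : ℝ} (h₁₂ : t₁ ≤ t₂) (h₂₃ : t₂ ≤ t₃)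
    (h₁ : hPt h u t₁ ∈ E) (h₃ : hPt h u t₃ ∈ E) : hPt h u t₂ ∈ E :=
  mem_of_isPreconnected_range_hPt hu (hE _ (isLine_range_hPt h hu)).1 h₁₂ h₂₃ h₁ h₃

lemma IsPreciselyMonotone.compl {E : Set Heis} (hE : IsPreciselyMonotone E) :
    IsPreciselyMonotone Eᶜ := fun L hL => by
  rw [compl_compl]
  exact (hE L hL).symm

/-- Given a line with points `p` at time `0` and `r` at time `ρ`, nearby points `p'` and `x` can be
joined by a broken line made of two lines close to the given one, switching at time `s`. -/
lemma eventually_exists_broken_line (p : Heis) {v : ℝ × ℝ} (hv : v ≠ 0) {ρ s : ℝ} (hρ : ρ ≠ 0)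
    (hs : s ≠ 0) (hsρ : s ≠ ρ) {P : Heis × (ℝ × ℝ) → Prop} (hP : ∀ᶠ l in 𝓝 (p, v), P l) :
    ∀ᶠ z : Heis × Heis in 𝓝 (p, hPt p v ρ), ∃ w h u, P (z.1, w) ∧ P (h, u) ∧
      hPt z.1 w s = hPt h u s ∧ hPt h u ρ = z.2 := by
  let X : Heis × Heis → ℝ × ℝ := fun z => (z.2.1 - z.1.1, z.2.2.1 - z.1.2.1)
  let N : Heis × Heis → ℝ := fun z => (X z).1 ^ 2 + (X z).2 ^ 2
  let Z : Heis × Heis → ℝ := fun z =>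
    z.2.2.2 - z.1.2.2 - z.1.1 * (X z).2 - (X z).1 * (X z).2 / 2
  let θ : Heis × Heis → ℝ := fun z => 2 * Z z / (s * N z)
  let w : Heis × Heis → ℝ × ℝ := fun z =>
    ((X z).1 / ρ + θ z * (X z).2, (X z).2 / ρ - θ z * (X z).1)
  let u : Heis × Heis → ℝ × ℝ := fun z =>
    (((X z).1 - s * (w z).1) / (ρ - s), ((X z).2 - s * (w z).2) / (ρ - s))
  let h : Heis × Heis → Heis := fun z => hPt (hPt z.1 (w z) s) (u z) (-s)
  have hρs : ρ - s ≠ 0 := sub_ne_zero.2 hsρ.symm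
  set z₀ : Heis × Heis := (p, hPt p v ρ)
  have hX₀ : X z₀ = (ρ * v.1, ρ * v.2) := by simp [X, z₀, hPt, hMul]
  have hN₀ : N z₀ ≠ 0 := by
    have : N z₀ = ρ ^ 2 * (v.1 ^ 2 + v.2 ^ 2) := by simp only [N, hX₀]; ring
    rw [this]
    exact mul_ne_zero (pow_ne_zero 2 hρ) (sq_add_sq_pos hv).ne'
  have hZ₀ : Z z₀ = 0 := by
    simp only [Z, hX₀]
    simp only [z₀, hPt, hMul]
    ring
  have hw₀ : w z₀ = v := by
    simp only [w, θ, hZ₀, hX₀]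
    ext <;> simp <;> field_simp
  have hu₀ : u z₀ = v := by
    simp only [u, hw₀, hX₀]
    ext <;> simp only <;> field_simp
  have hh₀ : h z₀ = p := by
    simp only [h, hw₀, hu₀]
    simp only [z₀, hPt, hMul]
    ext <;> simp only <;> ring
  have hXc : Continuous X := by fun_prop
  have hNc : Continuous N := by fun_prop
  have hZc : Continuous Z := by fun_prop
  have hθc : ContinuousAt θ z₀ :=
    (continuous_const.mul hZc).continuousAt.div (continuous_const.mul hNc).continuousAt
      (mul_ne_zero hs hN₀)
  have hwc : ContinuousAt w z₀ := by
    have := hXc.continuousAt (x := z₀)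
    fun_prop
  have huc : ContinuousAt u z₀ := by
    have := hXc.continuousAt (x := z₀)
    fun_prop
  have hhc : ContinuousAt h z₀ := by
    unfold h hPt hMul
    fun_prop
  have hPw : ∀ᶠ z in 𝓝 z₀, P (z.1, w z) := by
    have hc : ContinuousAt (fun z : Heis × Heis => (z.1, w z)) z₀ := continuousAt_fst.prodMk hwc
    refine hc.eventually ?_
    simpa only [hw₀] using hP
  have hPu : ∀ᶠ z in 𝓝 z₀, P (h z, u z) := by
    have hc : ContinuousAt (fun z : Heis × Heis => (h z, u z)) z₀ := hhc.prodMk huc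
    refine hc.eventually ?_
    simpa only [hu₀, hh₀] using hP
  filter_upwards [hPw, hPu, hNc.continuousAt.eventually_ne hN₀] with z h₁ h₂ hN
  refine ⟨w z, h z, u z, h₁, h₂, ?_, ?_⟩
  · simp only [h]
    simp only [hPt, hMul]
    ext <;> simp only <;> ring
  · have hθ : θ z * s * N z = 2 * Z z := by
      simp only [θ]
      field_simp
    have hu₁ : (ρ - s) * (u z).1 = (X z).1 - s * (w z).1 := by
      simp only [u]
      field_simp
    have hu₂ : (ρ - s) * (u z).2 = (X z).2 - s * (w z).2 := by
      simp only [u]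
      field_simp
    have hw : (w z).1 * (X z).2 - (w z).2 * (X z).1 = θ z * N z := by
      simp only [w, N]
      ring
    have key : s * ((w z).1 * (X z).2 - (w z).2 * (X z).1) = 2 * Z z := by
      rw [hw]
      linarith
    have hX₁ : (X z).1 = z.2.1 - z.1.1 := rfl
    have hX₂ : (X z).2 = z.2.2.1 - z.1.2.1 := rfl
    have hZ : Z z = z.2.2.2 - z.1.2.2 - z.1.1 * (X z).2 - (X z).1 * (X z).2 / 2 := rfl
    have e₁ : (X z).1 = (ρ - s) * (u z).1 + s * (w z).1 := by linarith
    have e₂ : (X z).2 = (ρ - s) * (u z).2 + s * (w z).2 := by linarith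
    simp only [h, hPt, hMul]
    ext
    · simp only
      linarith
    · simp only
      linarith
    · simp only
      rw [e₁, e₂] at key
      rw [e₁, e₂] at hZ
      linear_combination hZ + key / 2

/-- All lines near the one through `p` with direction `v` meet `E` at a time near `1`. -/
def MeetsNearby (E : Set Heis) (p : Heis) (v : ℝ × ℝ) : Prop :=
  ∀ ε > 0, ∀ᶠ l in 𝓝 (p, v), ∃ t, |t - 1| < ε ∧ hPt l.1 l.2 t ∈ E

lemma IsPreciselyMonotone.hPt_mem_interior_of_notMem {E : Set Heis} (hE : IsPreciselyMonotone E)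
    {p : Heis} {v : ℝ × ℝ} (hv : v ≠ 0) (hcross : MeetsNearby E p v) (hp : p ∉ E) {ρ : ℝ}
    (hρ : 1 < ρ) : hPt p v ρ ∈ interior E := by
  have hP := (hcross (min 1 (ρ - 1)) (lt_min one_pos (by linarith))).and
    (continuousAt_snd.eventually_ne (x := (p, v)) hv)
  have hev := eventually_exists_broken_line p hv (ρ := ρ) (s := -1) (by linarith) (by norm_num)
    (by linarith) hP
  rw [mem_interior_iff_mem_nhds]
  filter_upwards [(Continuous.prodMk_right p).continuousAt.eventually hev] with x hx
  obtain ⟨w, h, u, ⟨⟨t, ht, htE⟩, hw⟩, ⟨⟨t', ht', htE'⟩, hu⟩, hy, hxu⟩ := hx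
  by_contra hxE
  rw [lt_min_iff, abs_lt, abs_lt] at ht ht'
  dsimp only at *
  have hyE : hPt h u (-1) ∈ E := by
    by_contra hyE
    exact hE.compl.mem_of_mem hu (t₁ := -1) (t₂ := t') (t₃ := ρ) (by linarith) (by linarith)
      hyE (by rwa [hxu]) htE'
  have := hE.mem_of_mem hw (t₁ := -1) (t₂ := 0) (t₃ := t) (by linarith) (by linarith)
    (hy ▸ hyE) htE
  exact hp (by simpa [hPt, hMul] using this)

lemma IsPreciselyMonotone.hPt_mem_interior_of_mem_closure {E : Set Heis}
    (hE : IsPreciselyMonotone E) {p : Heis} {v : ℝ × ℝ} (hv : v ≠ 0) (hcross : MeetsNearby E p v)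
    (hp : p ∈ closure E) {ρ : ℝ} (hρ : 0 < ρ) (hρ' : ρ < 1) : hPt p v ρ ∈ interior E := by
  have hP := (hcross (1 - ρ) (by linarith)).and
    (continuousAt_snd.eventually_ne (x := (p, v)) hv)
  have hev := eventually_exists_broken_line p hv (ρ := ρ) (s := ρ / 2) (by linarith) (by linarith)
    (by linarith) hP
  obtain ⟨p', hp', hev'⟩ := ((mem_closure_iff_frequently.1 hp).and_eventually
    hev.curry_nhds).exists
  rw [mem_interior_iff_mem_nhds]
  filter_upwards [hev'] with x hx
  obtain ⟨w, h, u, ⟨⟨t, ht, htE⟩, hw⟩, ⟨⟨t', ht', htE'⟩, hu⟩, hy, hxu⟩ := hx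
  rw [abs_lt] at ht ht'
  dsimp only at *
  have hyE : hPt p' w (ρ / 2) ∈ E :=
    hE.mem_of_mem hw (t₁ := 0) (t₃ := t) (by linarith) (by linarith)
      (by simpa [hPt, hMul] using hp') htE
  rw [← hxu]
  exact hE.mem_of_mem hu (t₁ := ρ / 2) (t₃ := t') (by linarith) (by linarith) (hy ▸ hyE) htE'

/-- A `C¹` surface is locally the zero set of a function whose derivative is nonzero in a given
transverse direction. -/
lemma exists_defining_function {U : Set (ℝ × ℝ)} (hU : IsOpen U) {φ : ℝ × ℝ → Heis} {w₀ : ℝ × ℝ}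
    (hw₀ : w₀ ∈ U) (hφ : ContDiffOn ℝ 1 φ U) {D : (ℝ × ℝ) →L[ℝ] Heis} {dv : Heis}
    (hD : HasFDerivAt φ D w₀)
    (htrans : Submodule.span ℝ (range (fun w => D w) ∪ {dv}) = ⊤) :
    ∃ (F : Heis → ℝ) (F' : Heis →L[ℝ] ℝ), HasFDerivAt F F' (φ w₀) ∧ F (φ w₀) = 0 ∧ F' dv = 1 ∧
      ∀ᶠ x in 𝓝 (φ w₀), ContinuousAt F x ∧ (F x = 0 → x ∈ φ '' U) := by
  have hDs : HasStrictFDerivAt φ D w₀ :=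
    (hφ.contDiffAt (hU.mem_nhds hw₀)).hasStrictFDerivAt' hD one_ne_zero
  let A : ((ℝ × ℝ) × ℝ) →L[ℝ] Heis := D.coprod (ContinuousLinearMap.toSpanSingleton ℝ dv)
  let Ψ : (ℝ × ℝ) × ℝ → Heis := fun z => φ z.1 + z.2 • dv
  have hΨ : HasStrictFDerivAt Ψ A (w₀, 0) := by
    have h₁ : HasStrictFDerivAt (fun z : (ℝ × ℝ) × ℝ => φ z.1)
        (D.comp (ContinuousLinearMap.fst ℝ _ _)) (w₀, 0) :=
      HasStrictFDerivAt.comp (w₀, (0 : ℝ)) hDs hasStrictFDerivAt_fst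
    have h₂ : HasStrictFDerivAt (fun z : (ℝ × ℝ) × ℝ => z.2 • dv)
        ((ContinuousLinearMap.toSpanSingleton ℝ dv).comp (ContinuousLinearMap.snd ℝ _ _))
        (w₀, 0) :=
      ((ContinuousLinearMap.toSpanSingleton ℝ dv).comp
        (ContinuousLinearMap.snd ℝ (ℝ × ℝ) ℝ)).hasStrictFDerivAt
    have hA : A = D.comp (ContinuousLinearMap.fst ℝ _ _) +
        (ContinuousLinearMap.toSpanSingleton ℝ dv).comp (ContinuousLinearMap.snd ℝ _ _) :=
      ContinuousLinearMap.ext fun z => by simp [A]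
    rw [hA]
    exact h₁.add h₂
  have hsurj : Function.Surjective A := by
    refine (LinearMap.range_eq_top (f := A.toLinearMap)).1 ?_
    rw [eq_top_iff, ← htrans, Submodule.span_le]
    rintro x (⟨w, rfl⟩ | rfl)
    · exact ⟨(w, 0), by simp [A]⟩
    · exact ⟨(0, 1), by simp [A]⟩
  have hinj : Function.Injective A :=
    (LinearMap.injective_iff_surjective_of_finrank_eq_finrank (f := A.toLinearMap)
      (by simp [Heis])).2 hsurj
  let B : ((ℝ × ℝ) × ℝ) ≃L[ℝ] Heis :=
    (LinearEquiv.ofBijective A.toLinearMap ⟨hinj, hsurj⟩).toContinuousLinearEquiv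
  have hB : (B : ((ℝ × ℝ) × ℝ) →L[ℝ] Heis) = A := by ext <;> rfl
  have hΨB : HasStrictFDerivAt Ψ (B : ((ℝ × ℝ) × ℝ) →L[ℝ] Heis) (w₀, 0) := hB ▸ hΨ
  let e := hΨB.toOpenPartialHomeomorph Ψ
  have hΨ₀ : Ψ (w₀, 0) = φ w₀ := by simp [Ψ]
  have hmem : φ w₀ ∈ e.target := hΨ₀ ▸ hΨB.image_mem_toOpenPartialHomeomorph_target
  have hsymm₀ : e.symm (φ w₀) = (w₀, 0) := by
    rw [← hΨ₀]
    exact e.left_inv hΨB.mem_toOpenPartialHomeomorph_source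
  have hder : HasFDerivAt e.symm (B.symm : Heis →L[ℝ] ((ℝ × ℝ) × ℝ)) (φ w₀) := by
    rw [← hΨ₀]
    exact hΨB.to_localInverse.hasFDerivAt
  refine ⟨fun x => (e.symm x).2, (ContinuousLinearMap.snd ℝ _ _).comp
    (B.symm : Heis →L[ℝ] ((ℝ × ℝ) × ℝ)), hder.snd, congrArg Prod.snd hsymm₀, ?_, ?_⟩
  · have : B.symm dv = (0, 1) := by
      rw [ContinuousLinearEquiv.symm_apply_eq]
      change dv = A (0, 1)
      simp [A]
    simp [this]
  · have hUev : ∀ᶠ x in 𝓝 (φ w₀), (e.symm x).1 ∈ U :=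
      hder.continuousAt.fst.eventually (hU.mem_nhds (by simpa only [hsymm₀] using hw₀))
    filter_upwards [e.open_target.mem_nhds hmem, hUev] with x hx hxU
    refine ⟨(e.continuousAt_symm hx).snd, fun h0 => ⟨(e.symm x).1, hxU, ?_⟩⟩
    have h := e.right_inv hx
    change φ (e.symm x).1 + (e.symm x).2 • dv = x at h
    simpa [h0] using h

/-- Curves near one which crosses a zero set `{F = 0}` transversely also meet it. -/
lemma eventually_exists_mem_of_hasDerivAt {P : Type*} [TopologicalSpace P] {c : P × ℝ → Heis}
    (hc : Continuous c) {l₀ : P} {t₀ k : ℝ} {F : Heis → ℝ} (hF₀ : F (c (l₀, t₀)) = 0)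
    (hF : HasDerivAt (fun t => F (c (l₀, t))) k t₀) (hk : 0 < k) {S : Set Heis}
    (hS : ∀ᶠ x in 𝓝 (c (l₀, t₀)), ContinuousAt F x ∧ (F x = 0 → x ∈ S)) {ε : ℝ} (hε : 0 < ε) :
    ∀ᶠ l in 𝓝 l₀, ∃ t, |t - t₀| < ε ∧ c (l, t) ∈ S := by
  have hS' := hc.continuousAt.eventually hS
  rw [nhds_prod_eq, eventually_prod_iff] at hS'
  obtain ⟨pa, hpa, pb, hpb, hgood⟩ := hS'
  obtain ⟨δ, hδ, hball⟩ := Metric.eventually_nhds_iff.1 hpb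
  set η := min δ ε
  have hη₀ : 0 < η := lt_min hδ hε
  have hslope := (hasDerivAt_iff_tendsto_slope.1 hF).eventually (lt_mem_nhds hk)
  have hleft : ∃ t₁ < t₀, t₀ - η < t₁ ∧ F (c (l₀, t₁)) < 0 := by
    have h₁ := hslope.filter_mono (nhdsWithin_mono t₀ (fun x (hx : x ∈ Iio t₀) => ne_of_lt hx))
    obtain ⟨t, ht, ht', hts⟩ := (h₁.and (Ioo_mem_nhdsLT (by linarith : t₀ - η < t₀))).exists
    refine ⟨t, hts, ht', ?_⟩
    rw [slope_def_field, hF₀, sub_zero] at ht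
    by_contra! h
    exact absurd ht (not_lt.2 (div_nonpos_of_nonneg_of_nonpos h (by linarith)))
  have hright : ∃ t₂ > t₀, t₂ < t₀ + η ∧ 0 < F (c (l₀, t₂)) := by
    have h₁ := hslope.filter_mono (nhdsWithin_mono t₀ (fun x (hx : x ∈ Ioi t₀) => ne_of_gt hx))
    obtain ⟨t, ht, hts, ht'⟩ := (h₁.and (Ioo_mem_nhdsGT (by linarith : t₀ < t₀ + η))).exists
    refine ⟨t, hts, ht', ?_⟩
    rw [slope_def_field, hF₀, sub_zero] at ht
    exact (div_pos_iff_of_pos_right (by linarith)).1 ht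
  obtain ⟨t₁, h₁, h₁', hF₁⟩ := hleft
  obtain ⟨t₂, h₂, h₂', hF₂⟩ := hright
  have hpbt : ∀ t ∈ Icc t₁ t₂, |t - t₀| < η := fun t ht => by
    rw [abs_lt]
    constructor <;> linarith [ht.1, ht.2]
  have hcont : ∀ l, pa l → ∀ t ∈ Icc t₁ t₂, ContinuousAt (fun l' => F (c l')) (l, t) :=
    fun l hl t ht => ContinuousAt.comp (f := c)
      (hgood hl (hball ((hpbt t ht).trans_le (min_le_left _ _)))).1 hc.continuousAt
  have hslice : ∀ t ∈ Icc t₁ t₂, ContinuousAt (fun l => F (c (l, t))) l₀ := fun t ht =>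
    ContinuousAt.comp (f := fun l => (l, t)) (hcont l₀ hpa.self_of_nhds t ht)
      (Continuous.prodMk_left t).continuousAt
  have h₁₂ : t₁ ≤ t₂ := by linarith
  filter_upwards [hpa, (hslice t₁ (left_mem_Icc.2 h₁₂)).eventually (gt_mem_nhds hF₁),
    (hslice t₂ (right_mem_Icc.2 h₁₂)).eventually (lt_mem_nhds hF₂)] with l hl hl₁ hl₂
  have hivt := intermediate_value_Icc h₁₂ (f := fun t => F (c (l, t))) fun t ht =>
    (ContinuousAt.comp (f := fun t => (l, t)) (hcont l hl t ht)
      (Continuous.prodMk_right l).continuousAt).continuousWithinAt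
  obtain ⟨t, ht, ht₀⟩ := hivt ⟨hl₁.le, hl₂.le⟩
  exact ⟨t, (hpbt t ht).trans_le (min_le_right _ _),
    (hgood hl (hball ((hpbt t ht).trans_le (min_le_left _ _)))).2 ht₀⟩

/-- Let `E ⊆ H` be precisely monotone, `L` the line `γ(t) = g·(ta,tb,t²ab/2)`,
`p = γ(s₀) ∈ L`, and `Σ = φ(U)` a C¹ embedded surface meeting `L` transversely in the
single point `q = γ(t₀) ≠ p`.  If `Σ ⊆ E` then: (1) if `p ∉ int(Eᶜ)`, the open segment
of `L` between `p` and `q` lies in `int(E)`; (2) if `p ∈ Eᶜ`, the component of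
`L∖{q}` not containing `p` lies in `int(E)`.  The same holds with `E` and `Eᶜ`
exchanged. -/
theorem statement10 (E : Set Heis) (hE : IsPreciselyMonotone E)
    (g : Heis) (a b : ℝ) (hab : ¬(a = 0 ∧ b = 0))
    (γ : ℝ → Heis) (hγ : γ = fun t => hMul g (t * a, t * b, t ^ 2 * a * b / 2))
    (s₀ t₀ : ℝ) (hst : s₀ ≠ t₀)
    (U : Set (ℝ × ℝ)) (hUopen : IsOpen U)
    (φ : ℝ × ℝ → Heis) (w₀ : ℝ × ℝ) (hw₀ : w₀ ∈ U)
    (hφ : ContDiffOn ℝ 1 φ U) (hφinj : Set.InjOn φ U)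
    (hq : φ w₀ = γ t₀)
    (hsingle : hLine g a b ∩ φ '' U = {γ t₀})
    (D : (ℝ × ℝ) →L[ℝ] Heis) (dv : Heis)
    (hD : HasFDerivAt φ D w₀) (hDinj : Function.Injective D)
    (hdv : HasDerivAt γ dv t₀)
    (htrans : Submodule.span ℝ (Set.range (fun w => D w) ∪ {dv}) = ⊤) :
    (φ '' U ⊆ E →
      (γ s₀ ∉ interior Eᶜ → γ '' Set.uIoo s₀ t₀ ⊆ interior E) ∧
      (γ s₀ ∈ Eᶜ → γ '' {t : ℝ | 0 < (t - t₀) * (t₀ - s₀)} ⊆ interior E)) ∧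
    (φ '' U ⊆ Eᶜ →
      (γ s₀ ∉ interior E → γ '' Set.uIoo s₀ t₀ ⊆ interior Eᶜ) ∧
      (γ s₀ ∈ E → γ '' {t : ℝ | 0 < (t - t₀) * (t₀ - s₀)} ⊆ interior Eᶜ)) := by
  let p : Heis := γ s₀
  let k := t₀ - s₀
  let v : ℝ × ℝ := (k * a, k * b)
  have hk : k ≠ 0 := sub_ne_zero.2 hst.symm
  have hv : v ≠ 0 := fun h => hab
    ⟨(mul_eq_zero.1 (congrArg Prod.fst h)).resolve_left hk,
      (mul_eq_zero.1 (congrArg Prod.snd h)).resolve_left hk⟩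
  have hpt : ∀ τ, hPt p v τ = γ (s₀ + τ * k) := fun τ => by
    simp only [p, v, hPt, hγ, hMul]
    ext <;> simp only <;> ring
  have hpt' : ∀ t, γ t = hPt p v ((t - s₀) / k) := fun t => by
    rw [hpt]
    congr 1
    field_simp
    ring
  have hpt₁ : hPt p v 1 = φ w₀ := by
    rw [hpt, hq]
    congr 1
    simp only [k]
    ring
  obtain ⟨F, F', hF, hF₀, hF', hS⟩ := exists_defining_function hUopen hw₀ hφ hD htrans
  have hmeets : MeetsNearby (φ '' U) p v := by
    intro ε hε
    have hd : HasDerivAt (fun τ => hPt p v τ) (k • dv) 1 := by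
      have h₁ : HasDerivAt (fun τ : ℝ => s₀ + τ * k) k 1 := by
        simpa using ((hasDerivAt_id (1 : ℝ)).mul_const k).const_add s₀
      have h₂ : HasDerivAt γ dv (s₀ + 1 * k) := by
        convert hdv using 1
        simp only [k]
        ring
      simp only [hpt]
      exact HasDerivAt.scomp (1 : ℝ) h₂ h₁
    have hFd : HasDerivAt (fun τ => F (hPt p v τ)) k 1 := by
      have := HasFDerivAt.comp_hasDerivAt (1 : ℝ) (hpt₁ ▸ hF) hd
      rwa [map_smul, hF', smul_eq_mul, mul_one] at this
    rcases hk.lt_or_gt with hneg | hpos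
    · refine eventually_exists_mem_of_hasDerivAt (F := fun x => -F x) (l₀ := (p, v)) (t₀ := 1)
        continuous_hPt ?_ hFd.neg (neg_pos.2 hneg) ?_ hε
      · simp only [hpt₁, hF₀, neg_zero]
      · simp only [hpt₁]
        filter_upwards [hS] with x hx
        exact ⟨hx.1.neg, fun h => hx.2 (neg_eq_zero.1 h)⟩
    · refine eventually_exists_mem_of_hasDerivAt (F := F) (l₀ := (p, v)) (t₀ := 1)
        continuous_hPt ?_ hFd hpos ?_ hε
      · simp only [hpt₁, hF₀]
      · simpa only [hpt₁] using hS
  have main : ∀ A : Set Heis, IsPreciselyMonotone A → φ '' U ⊆ A →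
      (γ s₀ ∉ interior Aᶜ → γ '' Set.uIoo s₀ t₀ ⊆ interior A) ∧
      (γ s₀ ∈ Aᶜ → γ '' {t : ℝ | 0 < (t - t₀) * (t₀ - s₀)} ⊆ interior A) := by
    intro A hA hUA
    have hmA : MeetsNearby A p v := fun ε hε =>
      (hmeets ε hε).mono fun l ⟨t, ht, htU⟩ => ⟨t, ht, hUA htU⟩
    refine ⟨fun hp => ?_, fun hp => ?_⟩ <;> rintro _ ⟨t, ht, rfl⟩ <;> rw [hpt']
    · rw [interior_compl, notMem_compl_iff] at hp
      have h01 : 0 < (t - s₀) / k ∧ (t - s₀) / k < 1 := by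
        rcases hk.lt_or_gt with hneg | hpos
        · rw [uIoo_of_ge (by simp only [k] at hneg; linarith)] at ht
          rw [div_lt_one_of_neg hneg]
          exact ⟨div_pos_of_neg_of_neg (by linarith [ht.2]) hneg, by linarith [ht.1]⟩
        · rw [uIoo_of_le (by simp only [k] at hpos; linarith)] at ht
          rw [div_lt_one hpos]
          exact ⟨div_pos (by linarith [ht.1]) hpos, by linarith [ht.2]⟩
      exact hA.hPt_mem_interior_of_mem_closure hv hmA hp h01.1 h01.2
    · refine hA.hPt_mem_interior_of_notMem hv hmA hp ?_
      have h1 : (t - s₀) / k = 1 + (t - t₀) * k / k ^ 2 := by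
        field_simp
        simp only [k]
        ring
      rw [h1]
      exact lt_add_of_pos_right 1 (div_pos ht (by positivity))
  refine ⟨main E hE, fun h => ?_⟩
  have := main Eᶜ hE.compl h
  rwa [compl_compl] at this
end
end

section
/- Let E ⊆ H be precisely monotone and let ∂E denote the topological frontier of E. Then ∂E is the union of the lines it contains: for every x ∈ ∂E there exists a line L of H with x ∈ L and L ⊆ ∂E. -/
open MeasureTheory Set Topology Filter

noncomputable section

/-- The point `g·exp(a,b)` reached from `g` along the horizontal vector `(a,b)`. -/
def hFlow (g : Heis) (a b : ℝ) : Heis := hMul g (a, b, a * b / 2)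

lemma hFlow_hFlow_mul (g : Heis) (a b s t : ℝ) :
    hFlow (hFlow g (s * a) (s * b)) (t * a) (t * b) = hFlow g ((s + t) * a) ((s + t) * b) := by
  simp only [hFlow, hMul, Prod.mk.injEq]
  refine ⟨?_, ?_, ?_⟩ <;> ring

lemma hFlow_zero (g : Heis) : hFlow g 0 0 = g := by
  simp [hFlow, hMul]

lemma mem_hLine_iff {g p : Heis} {a b : ℝ} :
    p ∈ hLine g a b ↔ ∃ t : ℝ, p = hFlow g (t * a) (t * b) := by
  have h (t : ℝ) : t ^ 2 * a * b / 2 = t * a * (t * b) / 2 := by ring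
  simp only [hLine, hFlow, mem_ofPred_eq, h]

lemma continuous_hFlow : Continuous fun z : Heis × ℝ × ℝ => hFlow z.1 z.2.1 z.2.2 := by
  unfold hFlow hMul
  fun_prop

/-- Betweenness-closedness of `E` along horizontal lines. -/
def IsHConvex (E : Set Heis) : Prop :=
  ∀ (x : Heis) (a b r : ℝ), 0 ≤ r → hFlow x (-a) (-b) ∈ E → hFlow x (r * a) (r * b) ∈ E → x ∈ E

lemma isHConvex_of_isPreconnected {E : Set Heis}
    (hE : ∀ L, IsLine L → IsPreconnected (L ∩ E)) : IsHConvex E := by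
  intro x a b r hr h₁ h₂
  by_cases hab : a = 0 ∧ b = 0
  · simpa [hab.1, hab.2, hFlow_zero] using h₁
  have hpos : a ^ 2 + b ^ 2 ≠ 0 := by
    contrapose! hab
    constructor <;> nlinarith [sq_nonneg a, sq_nonneg b]
  let f : Heis → ℝ := fun p => (a * (p.1 - x.1) + b * (p.2.1 - x.2.1)) / (a ^ 2 + b ^ 2)
  have hf : Continuous f := by fun_prop
  have hfl (t : ℝ) : f (hFlow x (t * a) (t * b)) = t := by
    simp only [f, hFlow, hMul]
    field_simp
    ring
  have hI := ((hE _ ⟨x, a, b, hab, rfl⟩).image f hf.continuousOn).ordConnected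
  have hmem (t : ℝ) (ht : hFlow x (t * a) (t * b) ∈ E) : t ∈ f '' (hLine x a b ∩ E) :=
    ⟨_, ⟨mem_hLine_iff.2 ⟨t, rfl⟩, ht⟩, hfl t⟩
  obtain ⟨p, ⟨hpL, hpE⟩, hp⟩ :=
    hI.out (hmem (-1) (by simpa using h₁)) (hmem r h₂) (show (0 : ℝ) ∈ Icc (-1) r by simp [hr])
  obtain ⟨t, rfl⟩ := mem_hLine_iff.1 hpL
  rw [hfl] at hp
  simpa [hp, hFlow_zero] using hpE

/-- A point `q` is reached from `x` by two horizontal segments, whose directions are both close to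
the direction of `q` if `q` is close to the horizontal plane at `x`; the parameter `τ` measures the
deviation. -/
lemma hFlow_hFlow_eq {x q : Heis} {w₁ w₂ τ : ℝ} (h₁ : w₁ = q.1 - x.1) (h₂ : w₂ = q.2.1 - x.2.1)
    (hτ : τ * (w₁ ^ 2 + w₂ ^ 2) = -2 * (q.2.2 - x.2.2 - x.1 * w₂ - w₁ * w₂ / 2)) :
    hFlow (hFlow x (w₁ / 2 - τ * w₂) (w₂ / 2 + τ * w₁)) (w₁ / 2 + τ * w₂) (w₂ / 2 - τ * w₁) = q := by
  obtain ⟨x₁, x₂, x₃⟩ := x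
  obtain ⟨q₁, q₂, q₃⟩ := q
  simp only [hFlow, hMul, Prod.mk.injEq] at *
  refine ⟨by linarith, by linarith, by linear_combination (-1 / 2) * hτ⟩

/-- Past a point of the closure of the complement, a line coming from the interior of a horizontally
convex set runs in the interior of the complement. -/
lemma IsHConvex.hFlow_mem_interior_compl {E : Set Heis} (hE : IsHConvex E) {x : Heis}
    (hx : x ∈ closure Eᶜ) {a b r : ℝ} (hr : 0 < r) (hp : hFlow x (-a) (-b) ∈ interior E) :
    hFlow x (r * a) (r * b) ∈ interior Eᶜ := by
  have hab : ¬(a = 0 ∧ b = 0) := by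
    rintro ⟨rfl, rfl⟩
    rw [closure_compl] at hx
    exact hx (by simpa [hFlow_zero] using hp)
  have hpos : a ^ 2 + b ^ 2 ≠ 0 := by
    contrapose! hab
    constructor <;> nlinarith [sq_nonneg a, sq_nonneg b]
  set q := hFlow x (r * a) (r * b) with hq
  let w₁ : Heis × Heis → ℝ := fun z => z.2.1 - z.1.1
  let w₂ : Heis × Heis → ℝ := fun z => z.2.2.1 - z.1.2.1
  let τ : Heis × Heis → ℝ := fun z =>
    -2 * (z.2.2.2 - z.1.2.2 - z.1.1 * w₂ z - w₁ z * w₂ z / 2) / (w₁ z ^ 2 + w₂ z ^ 2)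
  have hw₁ : w₁ (x, q) = r * a := by simp [w₁, hq, hFlow, hMul]
  have hw₂ : w₂ (x, q) = r * b := by simp [w₂, hq, hFlow, hMul]
  have hw : w₁ (x, q) ^ 2 + w₂ (x, q) ^ 2 ≠ 0 := by
    rw [hw₁, hw₂, mul_pow, mul_pow, ← mul_add]
    exact mul_ne_zero (by positivity) hpos
  have hτ : τ (x, q) = 0 := by
    simp only [τ, hw₁, hw₂]
    simp only [hq, hFlow, hMul]
    ring
  have cw₁ : Continuous w₁ := by fun_prop
  have cw₂ : Continuous w₂ := by fun_prop
  have cτ : ContinuousAt τ (x, q) :=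
    ContinuousAt.div (by fun_prop) (by fun_prop) hw
  let y : Heis × Heis → Heis := fun z =>
    hFlow z.1 (w₁ z / 2 - τ z * w₂ z) (w₂ z / 2 + τ z * w₁ z)
  have cy : ContinuousAt y (x, q) :=
    continuous_hFlow.continuousAt.comp (f := fun z : Heis × Heis =>
      (z.1, w₁ z / 2 - τ z * w₂ z, w₂ z / 2 + τ z * w₁ z)) (by fun_prop)
  have hy : y (x, q) = hFlow x (r / 2 * a) (r / 2 * b) := by
    simp only [y, hτ, hw₁, hw₂]
    congr 1 <;> ring
  let p₁ : Heis × Heis → Heis := fun z =>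
    hFlow z.1 (-((2 / r) * (w₁ z / 2 - τ z * w₂ z))) (-((2 / r) * (w₂ z / 2 + τ z * w₁ z)))
  let p₂ : Heis × Heis → Heis := fun z =>
    hFlow (y z) (-((2 / r + 1) * (w₁ z / 2 + τ z * w₂ z)))
      (-((2 / r + 1) * (w₂ z / 2 - τ z * w₁ z)))
  have cp₁ : ContinuousAt p₁ (x, q) :=
    continuous_hFlow.continuousAt.comp (f := fun z : Heis × Heis =>
      (z.1, -((2 / r) * (w₁ z / 2 - τ z * w₂ z)), -((2 / r) * (w₂ z / 2 + τ z * w₁ z))))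
      (by fun_prop)
  have cp₂ : ContinuousAt p₂ (x, q) :=
    continuous_hFlow.continuousAt.comp (f := fun z : Heis × Heis =>
      (y z, -((2 / r + 1) * (w₁ z / 2 + τ z * w₂ z)), -((2 / r + 1) * (w₂ z / 2 - τ z * w₁ z))))
      (by fun_prop)
  have hp₁ : p₁ (x, q) = hFlow x (-a) (-b) := by
    simp only [p₁, hτ, hw₁, hw₂]
    congr 1 <;> field_simp <;> ring
  have hp₂ : p₂ (x, q) = hFlow x (-a) (-b) := by
    have key := hFlow_hFlow_mul x a b (r / 2) (-(1 + r / 2))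
    simp only [p₂, hy, hτ, hw₁, hw₂]
    convert key using 2 <;> field_simp <;> ring
  have e₁ : ∀ᶠ z in 𝓝 (x, q), p₁ z ∈ interior E :=
    cp₁.eventually_mem (isOpen_interior.mem_nhds (hp₁ ▸ hp))
  have e₂ : ∀ᶠ z in 𝓝 (x, q), p₂ z ∈ interior E :=
    cp₂.eventually_mem (isOpen_interior.mem_nhds (hp₂ ▸ hp))
  have e₃ : ∀ᶠ z in 𝓝 (x, q), w₁ z ^ 2 + w₂ z ^ 2 ≠ 0 :=
    ContinuousAt.eventually_ne (by fun_prop) hw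
  have main : ∀ᶠ z in 𝓝 (x, q), z.1 ∈ Eᶜ → z.2 ∈ Eᶜ := by
    filter_upwards [e₁, e₂, e₃] with z h₁ h₂ h₃ hz₁ hz₂
    have hyz : y z ∉ E := by
      intro hyE
      refine hz₁ (hE z.1 _ _ (r / 2) (by positivity) (interior_subset h₁) ?_)
      convert hyE using 1
      simp only [y]
      congr 1 <;> field_simp
    refine hyz (hE (y z) _ _ (2 / r + 1)⁻¹ (by positivity) (interior_subset h₂) ?_)
    have hne : 2 / r + 1 ≠ 0 := by positivity
    rw [inv_mul_cancel_left₀ hne, inv_mul_cancel_left₀ hne]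
    rwa [hFlow_hFlow_eq (x := z.1) (q := z.2) rfl rfl (div_mul_cancel₀ _ h₃)]
  rw [nhds_prod_eq] at main
  obtain ⟨x', hx', hev⟩ := ((mem_closure_iff_frequently.1 hx).and_eventually main.curry).exists
  exact mem_interior_iff_mem_nhds.2 (hev.mono fun _ h => h hx')

/-- If `E ⊆ H` is precisely monotone, then the topological frontier `∂E` is the union
of the lines it contains: through every point of `∂E` there is a line contained in
`∂E`. -/
theorem statement12 (E : Set Heis) (hE : IsPreciselyMonotone E) :
    ∀ x ∈ frontier E, ∃ L : Set Heis, IsLine L ∧ x ∈ L ∧ L ⊆ frontier E := by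
  intro x hx
  by_contra! hno
  have hcE : IsHConvex E := isHConvex_of_isPreconnected fun L hL => (hE L hL).1
  have hcE' : IsHConvex Eᶜ := isHConvex_of_isPreconnected fun L hL => (hE L hL).2
  have hx₁ : x ∈ closure Eᶜ := (frontier_eq_closure_inter_closure (s := E) ▸ hx).2
  have hx₂ : x ∈ closure Eᶜᶜ := by
    rw [compl_compl]
    exact hx.1
  have toCompl (a b r : ℝ) (hr : 0 < r) (h : hFlow x a b ∈ interior E) :
      hFlow x (-(r * a)) (-(r * b)) ∈ interior Eᶜ := by
    have := hcE.hFlow_mem_interior_compl hx₁ (a := -a) (b := -b) hr (by simpa using h)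
    simpa using this
  have ofCompl (a b r : ℝ) (hr : 0 < r) (h : hFlow x a b ∈ interior Eᶜ) :
      hFlow x (-(r * a)) (-(r * b)) ∈ interior E := by
    have := hcE'.hFlow_mem_interior_compl hx₂ (a := -a) (b := -b) hr (by simpa using h)
    simpa using this
  have cover (v : ℝ × ℝ) (hv : v ≠ 0) :
      hFlow x v.1 v.2 ∈ interior E ∨ hFlow x v.1 v.2 ∈ interior Eᶜ := by
    obtain ⟨a, b⟩ := v
    have hab : ¬(a = 0 ∧ b = 0) := by simpa using hv
    obtain ⟨p, hpL, hp⟩ := not_subset.1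
      (hno (hLine x a b) ⟨x, a, b, hab, rfl⟩ (mem_hLine_iff.2 ⟨0, by simp [hFlow_zero]⟩))
    obtain ⟨t, rfl⟩ := mem_hLine_iff.1 hpL
    have hp' : hFlow x (t * a) (t * b) ∈ interior E ∨ hFlow x (t * a) (t * b) ∈ interior Eᶜ := by
      rw [← mem_compl_iff, compl_frontier_eq_union_interior] at hp
      exact hp
    rcases lt_trichotomy t 0 with ht | rfl | ht
    · have hr : 0 < -t⁻¹ := by simpa using ht
      have hs (c : ℝ) : -(-t⁻¹ * (t * c)) = c := by
        rw [neg_mul, neg_neg, inv_mul_cancel_left₀ ht.ne]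
      rcases hp' with h | h
      · exact Or.inr (by simpa only [hs] using toCompl _ _ _ hr h)
      · exact Or.inl (by simpa only [hs] using ofCompl _ _ _ hr h)
    · simp only [zero_mul, hFlow_zero] at hp
      exact absurd hx hp
    · have hr : 0 < t⁻¹ := by simpa using ht
      have hs (c : ℝ) : -(t⁻¹ * -(1 * (t * c))) = c := by field_simp
      rcases hp' with h | h
      · exact Or.inl (by simpa only [hs] using ofCompl _ _ _ hr (toCompl _ _ 1 one_pos h))
      · exact Or.inr (by simpa only [hs] using toCompl _ _ _ hr (ofCompl _ _ 1 one_pos h))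
  have hcont : Continuous fun v : ℝ × ℝ => hFlow x v.1 v.2 :=
    continuous_hFlow.comp (g := fun z : Heis × ℝ × ℝ => hFlow z.1 z.2.1 z.2.2)
      (f := fun v : ℝ × ℝ => (x, v)) (by fun_prop)
  have hconn : IsPreconnected ({0}ᶜ : Set (ℝ × ℝ)) :=
    (isConnected_compl_singleton_of_one_lt_rank (by norm_num) 0).isPreconnected
  have hne (a b : ℝ) (h : (a, b) ≠ (0 : ℝ × ℝ)) : (-a, -b) ≠ (0 : ℝ × ℝ) := by
    simpa using h
  have nonempty : (∃ v : ℝ × ℝ, v ≠ 0 ∧ hFlow x v.1 v.2 ∈ interior E) ∧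
      ∃ v : ℝ × ℝ, v ≠ 0 ∧ hFlow x v.1 v.2 ∈ interior Eᶜ := by
    have h10 : ((1, 0) : ℝ × ℝ) ≠ 0 := by simp
    rcases cover (1, 0) h10 with h | h
    · exact ⟨⟨_, h10, h⟩, ⟨_, hne _ _ h10, by simpa using toCompl _ _ 1 one_pos h⟩⟩
    · exact ⟨⟨_, hne _ _ h10, by simpa using ofCompl _ _ 1 one_pos h⟩, ⟨_, h10, h⟩⟩
  obtain ⟨v, -, h₁, h₂⟩ := hconn _ _ (isOpen_interior.preimage hcont)
    (isOpen_interior.preimage hcont) cover nonempty.1 nonempty.2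
  exact interior_subset h₂ (interior_subset h₁)
end
end

section
/- Let E ⊆ H be precisely monotone. Then either E or its complement H∖E has nonempty topological interior; equivalently, the topological frontier ∂E is not all of H. -/
open MeasureTheory Set Topology Filter

noncomputable section

/-- Closure of a set under horizontal segments between its points. -/
def HorizontallyConvex (E : Set Heis) : Prop :=
  ∀ x y z a b t : ℝ, 0 ≤ t → t ≤ 1 → (x, y, z) ∈ E → (x + a, y + b, z + a * b / 2 + x * b) ∈ E →
    (x + t * a, y + t * b, z + t ^ 2 * a * b / 2 + x * (t * b)) ∈ E

/-- If a subset of every line that is cut out by `E` is connected, `E` is horizontally convex. -/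
theorem horizontallyConvex_of_isPreconnected {E : Set Heis}
    (hE : ∀ L, IsLine L → IsPreconnected (L ∩ E)) : HorizontallyConvex E := by
  intro x y z a b t ht0 ht1 hp hq
  by_cases hab : a = 0 ∧ b = 0
  · obtain ⟨rfl, rfl⟩ := hab
    simpa using hp
  have hpos : 0 < a ^ 2 + b ^ 2 := by
    rcases not_and_or.mp hab with h | h <;> positivity
  let f : Heis → ℝ := fun p => a * p.1 + b * p.2.1
  have hf : Continuous f := by fun_prop
  have hconn := ((hE _ ⟨(x, y, z), a, b, hab, rfl⟩).image f hf.continuousOn).ordConnected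
  obtain ⟨_, ⟨⟨τ, rfl⟩, hτ⟩, hfτ⟩ := hconn.out
    (x := f (x, y, z)) (y := f (x + a, y + b, z + a * b / 2 + x * b))
    ⟨_, ⟨⟨0, by simp [hMul]⟩, hp⟩, rfl⟩
    ⟨_, ⟨⟨1, by simp [hMul]⟩, hq⟩, rfl⟩
    (show f (x + t * a, y + t * b, z + t ^ 2 * a * b / 2 + x * (t * b)) ∈ Icc _ _ by
      constructor <;> simp only [f] <;> nlinarith)
  have hτt : τ = t := by
    simp only [f, hMul] at hfτ
    have : (τ - t) * (a ^ 2 + b ^ 2) = 0 := by linear_combination hfτ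
    rcases mul_eq_zero.mp this with h | h <;> linarith
  simpa [hMul, hτt] using hτ

/-- The point of height `y` on the line of slope `c` (measured as `dx / dy`) that meets the
`x`-axis at `(s, 0, 0)`. -/
def transversalPoint (s c y : ℝ) : Heis := (s + c * y, y, c * y ^ 2 / 2 + s * y)

theorem HorizontallyConvex.transversalPoint_mem {E : Set Heis} (hE : HorizontallyConvex E)
    {s c y₁ y y₂ : ℝ} (h₁ : y₁ ≤ y) (h₂ : y ≤ y₂) (hy₁ : transversalPoint s c y₁ ∈ E)
    (hy₂ : transversalPoint s c y₂ ∈ E) : transversalPoint s c y ∈ E := by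
  rcases h₁.eq_or_lt with rfl | h₁
  · exact hy₁
  have hpos : 0 < y₂ - y₁ := by linarith
  have key := hE (s + c * y₁) y₁ (c * y₁ ^ 2 / 2 + s * y₁) (c * (y₂ - y₁)) (y₂ - y₁)
    ((y - y₁) / (y₂ - y₁)) (by apply div_nonneg <;> linarith)
    (by rw [div_le_one hpos]; linarith) hy₁
    (by convert hy₂ using 1; simp only [transversalPoint, Prod.mk.injEq]
        refine ⟨?_, ?_, ?_⟩ <;> ring)
  convert key using 1
  simp only [transversalPoint, Prod.mk.injEq]
  refine ⟨?_, ?_, ?_⟩ <;> field_simp <;> ring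

/-- The transversal parameters are local coordinates off the plane `y = 0`. -/
theorem transversalPoint_mem_interior {E : Set Heis} {s c y : ℝ} (hy : y ≠ 0)
    (h : ∀ᶠ q : ℝ × ℝ × ℝ in 𝓝 (s, c, y), transversalPoint q.1 q.2.1 q.2.2 ∈ E) :
    transversalPoint s c y ∈ interior E := by
  rw [mem_interior_iff_mem_nhds]
  let g : Heis → ℝ × ℝ × ℝ := fun p =>
    (p.1 - 2 * (p.1 * p.2.1 - p.2.2) / p.2.1, 2 * (p.1 * p.2.1 - p.2.2) / p.2.1 ^ 2, p.2.1)
  have hg : ContinuousAt g (transversalPoint s c y) := by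
    have h₁ : (transversalPoint s c y).2.1 ≠ 0 := hy
    have h₂ : (transversalPoint s c y).2.1 ^ 2 ≠ 0 := pow_ne_zero 2 hy
    fun_prop (disch := assumption)
  have hgP : g (transversalPoint s c y) = (s, c, y) := by
    simp only [g, transversalPoint, Prod.mk.injEq, and_true]
    refine ⟨?_, ?_⟩ <;> field_simp <;> ring
  have hne : ∀ᶠ p : Heis in 𝓝 (transversalPoint s c y), p.2.1 ≠ 0 :=
    (continuous_fst.comp continuous_snd).continuousAt.eventually_ne hy
  have hev := hg.eventually (hgP ▸ h)
  filter_upwards [hev, hne] with p hp hp0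
  convert hp using 1
  obtain ⟨x, y', z⟩ := p
  have hy' : y' ≠ 0 := hp0
  simp only [g, transversalPoint, Prod.mk.injEq, true_and]
  refine ⟨?_, ?_⟩ <;> field_simp <;> ring

/-- A horizontal segment joining transversals on opposite sides of the `x`-axis, expressed in
transversal coordinates. -/
theorem HorizontallyConvex.transversalPoint_inv_mem {E : Set Heis} (hE : HorizontallyConvex E)
    {s c u k d e : ℝ} (hk : 0 < k) (hd : 0 < d) (he : 0 < e) (hu : 0 < u) (hu' : u - k * d < 0)
    (h₁ : transversalPoint s c (1 / u) ∈ E)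
    (h₂ : transversalPoint (s + d) (c - d * (2 * u - k * d)) (1 / (u - k * d)) ∈ E) :
    transversalPoint (s - e) (c + e * (2 * u + k * e)) (1 / (u + k * e)) ∈ E := by
  have hv : 0 < u + k * e := by positivity
  have hu0 := hu.ne'
  have hd0 := hd.ne'
  have hv0 := hv.ne'
  have hu0' := hu'.ne
  have hu0'' : u - d * k ≠ 0 := by rwa [mul_comm]
  have key := hE (s + c * (1 / u)) (1 / u) (c * (1 / u) ^ 2 / 2 + s * (1 / u))
    (s + d + (c - d * (2 * u - k * d)) * (1 / (u - k * d)) - (s + c * (1 / u)))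
    (1 / (u - k * d) - 1 / u) (e * (k * d - u) / (d * (u + k * e)))
    (div_nonneg (mul_nonneg he.le (by linarith)) (by positivity))
    (by rw [div_le_one (by positivity)]; nlinarith [mul_pos he hu, mul_pos hd hu]) h₁
    (by convert h₂ using 1; simp only [transversalPoint, Prod.mk.injEq]
        refine ⟨?_, ?_, ?_⟩ <;> field_simp <;> ring)
  convert key using 1
  simp only [transversalPoint, Prod.mk.injEq]
  refine ⟨?_, ?_, ?_⟩ <;> field_simp <;> ring

theorem HorizontallyConvex.interior_nonempty_of_opposite_rays {E : Set Heis}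
    (hE : HorizontallyConvex E) {a s s' c c' : ℝ} (ha : ∀ r, a < r → (r, 0, 0) ∈ E)
    (has : a < s) (hss : s < s') (hpos : ∀ y, 0 < y → transversalPoint s c y ∈ E)
    (hneg : ∀ y, y < 0 → transversalPoint s' c' y ∈ E) : (interior E).Nonempty := by
  set d := s' - s with hd_def
  have hd : 0 < d := sub_pos.mpr hss
  set κ := (c - c') / d with hκ
  -- The line joining the two transversals through a given third one, as slope and start.
  let k : ℝ × ℝ × ℝ → ℝ := fun q => ((q.2.1 - c) / (s - q.1) - κ) / (s' - q.1)
  let v : ℝ × ℝ × ℝ → ℝ := fun q => (κ + k q * d) / 2 + k q * (s - q.1)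
  have hmem : ∀ q : ℝ × ℝ × ℝ, a < q.1 → q.1 < s → |κ| < k q * d → 0 < q.2.2 →
      q.2.2 * v q < 1 → transversalPoint q.1 q.2.1 q.2.2 ∈ E := by
    intro q hq1 hq2 hq3 hq4 hq5
    have he : 0 < s - q.1 := sub_pos.mpr hq2
    have hk : 0 < k q := pos_of_mul_pos_left ((abs_nonneg κ).trans_lt hq3) hd.le
    have hu : 0 < (κ + k q * d) / 2 := by linarith [neg_abs_le κ]
    have hu' : (κ + k q * d) / 2 - k q * d < 0 := by linarith [le_abs_self κ]
    have hv : 0 < v q := by positivity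
    have hκd : κ * d = c - c' := by rw [hκ]; field_simp
    have hγ : (s - q.1) * (κ + k q * (s' - q.1)) = q.2.1 - c := by
      have : s' - q.1 ≠ 0 := by linarith
      simp only [k]
      field_simp
      ring
    have key := hE.transversalPoint_inv_mem (s := s) (c := c) hk hd he hu hu'
      (hpos _ (by positivity)) (by
        have h1 : s + d = s' := by rw [hd_def]; ring
        have h2 : c - d * (2 * ((κ + k q * d) / 2) - k q * d) = c' := by linear_combination -hκd
        rw [h1, h2]
        exact hneg _ (one_div_neg.mpr hu'))
    have h1 : s - (s - q.1) = q.1 := by ring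
    have h2 : c + (s - q.1) * (2 * ((κ + k q * d) / 2) + k q * (s - q.1)) = q.2.1 := by
      rw [hd_def]
      linear_combination hγ
    rw [h1, h2] at key
    refine hE.transversalPoint_mem hq4.le ?_ ?_ key
    · exact (le_div_iff₀ hv).mpr hq5.le
    · simpa [transversalPoint] using ha _ hq1
  let σ := (a + s) / 2
  have hσa : a < σ := by simp only [σ]; linarith
  have hσs : σ < s := by simp only [σ]; linarith
  have he : s - σ ≠ 0 := by linarith
  have he' : s' - σ ≠ 0 := by linarith
  let γ := c + (s - σ) * (κ + (|κ| + 1) / d * (s' - σ))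
  have hk0 : ∀ y, k (σ, γ, y) * d = |κ| + 1 := by
    intro y
    simp only [k, γ]
    field_simp
    ring
  have hv0 : 0 < v (σ, γ, 0) := by
    have hk : 0 < k (σ, γ, 0) :=
      pos_of_mul_pos_left (by rw [hk0]; positivity : 0 < k (σ, γ, 0) * d) hd.le
    have : 0 < s - σ := by linarith
    have : 0 < (κ + k (σ, γ, 0) * d) / 2 := by rw [hk0]; linarith [neg_abs_le κ]
    positivity
  let y := 1 / (2 * v (σ, γ, 0))
  have hy : 0 < y := by positivity
  have hyv : y * v (σ, γ, y) < 1 := by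
    have : y * v (σ, γ, y) = 1 / 2 := by
      change 1 / (2 * v (σ, γ, 0)) * v (σ, γ, 0) = 1 / 2
      field_simp
    linarith
  have hkc : ContinuousAt k (σ, γ, y) := by
    have h₁ : s - ((σ, γ, y) : ℝ × ℝ × ℝ).1 ≠ 0 := he
    have h₂ : s' - ((σ, γ, y) : ℝ × ℝ × ℝ).1 ≠ 0 := he'
    fun_prop (disch := assumption)
  have hvc : ContinuousAt v (σ, γ, y) := by fun_prop
  have c₁ : ContinuousAt (fun q : ℝ × ℝ × ℝ => q.1) (σ, γ, y) := by fun_prop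
  have c₂ : ContinuousAt (fun q : ℝ × ℝ × ℝ => q.2.2) (σ, γ, y) := by fun_prop
  refine ⟨_, transversalPoint_mem_interior (s := σ) (c := γ) hy.ne' ?_⟩
  filter_upwards [c₁.eventually (lt_mem_nhds hσa), c₁.eventually (gt_mem_nhds hσs),
    (hkc.mul continuousAt_const).eventually
      (lt_mem_nhds (by rw [hk0]; linarith : |κ| < k (σ, γ, y) * d)),
    c₂.eventually (lt_mem_nhds hy), (c₂.mul hvc).eventually (gt_mem_nhds hyv)]
    with q h1 h2 h3 h4 h5 using hmem q h1 h2 h3 h4 h5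

theorem HorizontallyConvex.interior_nonempty_of_ray {E : Set Heis} (hE : HorizontallyConvex E)
    (hEc : HorizontallyConvex Eᶜ) {a : ℝ} (ha : ∀ r, a < r → (r, 0, 0) ∈ E) :
    (interior E).Nonempty := by
  have hsplit : ∀ s c, a < s → (¬ ∀ y, 0 < y → transversalPoint s c y ∈ E) →
      ∀ y, y < 0 → transversalPoint s c y ∈ E := by
    intro s c hs hnot y hy
    push Not at hnot
    obtain ⟨y', hy', hmem⟩ := hnot
    by_contra hcon
    have h0 := hEc.transversalPoint_mem hy.le hy'.le hcon hmem
    exact h0 (by simpa [transversalPoint] using ha s hs)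
  have hc₁ : Continuous fun q : ℝ × ℝ × ℝ => q.1 := by fun_prop
  have hc₂ : Continuous fun q : ℝ × ℝ × ℝ => q.2.2 := by fun_prop
  by_cases hall : ∀ s c, a < s → ∀ y, 0 < y → transversalPoint s c y ∈ E
  · refine ⟨_, transversalPoint_mem_interior (s := a + 1) (c := 0) (y := 1) one_ne_zero ?_⟩
    filter_upwards [hc₁.continuousAt.eventually (lt_mem_nhds (lt_add_one a)),
      hc₂.continuousAt.eventually (lt_mem_nhds one_pos)] with q h1 h2 using hall _ _ h1 _ h2
  · push Not at hall
    obtain ⟨s', c', hs', y', hy', hmem⟩ := hall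
    have hneg := hsplit s' c' hs' fun h => hmem (h y' hy')
    by_cases hex : ∃ s c, a < s ∧ s < s' ∧ ∀ y, 0 < y → transversalPoint s c y ∈ E
    · obtain ⟨s, c, has, hss, hpos⟩ := hex
      exact hE.interior_nonempty_of_opposite_rays ha has hss hpos hneg
    · refine ⟨_, transversalPoint_mem_interior (s := (a + s') / 2) (c := 0) (y := -1)
        (by norm_num) ?_⟩
      filter_upwards [hc₁.continuousAt.eventually (lt_mem_nhds (by linarith : a < (a + s') / 2)),
        hc₁.continuousAt.eventually (gt_mem_nhds (by linarith : (a + s') / 2 < s')),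
        hc₂.continuousAt.eventually (gt_mem_nhds (by norm_num : (-1 : ℝ) < 0))] with q h1 h2 h3
      exact hsplit _ _ h1 (fun h => hex ⟨_, _, h1, h2, h⟩) _ h3

/-- A ray of the `x`-axis lies in `E` or in its complement. -/
theorem HorizontallyConvex.exists_ray {E : Set Heis} (hE : HorizontallyConvex E) :
    ∃ a : ℝ, (∀ r, a < r → (r, 0, 0) ∈ E) ∨ ∀ r, a < r → (r, 0, 0) ∈ Eᶜ := by
  by_cases h : ∃ a, ∀ r, a < r → ((r, 0, 0) : Heis) ∈ Eᶜ
  · exact h.imp fun a ha => Or.inr ha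
  push Not at h
  obtain ⟨a, -, ha⟩ := h 0
  refine ⟨a, Or.inl fun r hr => ?_⟩
  obtain ⟨b, hb, hbE⟩ := h r
  have hab : 0 < b - a := by linarith
  have key := hE a 0 0 (b - a) 0 ((r - a) / (b - a)) (div_nonneg (by linarith) hab.le)
    (by rw [div_le_one hab]; linarith) (not_not.mp ha) (by simpa using hbE)
  convert key using 1
  simp only [Prod.mk.injEq]
  refine ⟨?_, ?_, ?_⟩ <;> field_simp <;> ring

/-- If `E ⊆ H` is precisely monotone, then `E` or its complement has nonempty
interior; equivalently `∂E ≠ H`. -/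
theorem statement15 (E : Set Heis) (hE : IsPreciselyMonotone E) :
    ((interior E).Nonempty ∨ (interior Eᶜ).Nonempty) ∧ frontier E ≠ Set.univ := by
  have hconv : HorizontallyConvex E :=
    horizontallyConvex_of_isPreconnected fun L hL => (hE L hL).1
  have hconvc : HorizontallyConvex Eᶜ :=
    horizontallyConvex_of_isPreconnected fun L hL => (hE L hL).2
  have hint : (interior E).Nonempty ∨ (interior Eᶜ).Nonempty := by
    obtain ⟨a, ha | ha⟩ := hconv.exists_ray
    · exact Or.inl (hconv.interior_nonempty_of_ray hconvc ha)
    · exact Or.inr (hconvc.interior_nonempty_of_ray (by rwa [compl_compl]) ha)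
  refine ⟨hint, fun hfr => ?_⟩
  rcases hint with ⟨p, hp⟩ | ⟨p, hp⟩
  · exact (hfr ▸ mem_univ p : p ∈ frontier E).2 hp
  · exact (frontier_compl E ▸ hfr ▸ mem_univ p : p ∈ frontier Eᶜ).2 hp
end
end
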